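/- arXiv:2505.07292 — 2 statements merged into one kernel-verified Lean document; each statement's English description precedes it below -/
import Mathlib

section
/- (The free boundary has measure zero.) Let φ₋, φ₊ : ℝ^d → ℝ be non-constant C⁴, (2πℤ)^d-periodic functions with φ₊ − φ₋ ≥ τ everywhere for some τ > 0, assume max φ₋ > min φ₊, and assume ∇(Δφ₋) ≠ 0 at every point of (Δφ₋)^{−1}(0) and ∇(Δφ₊) ≠ 0 at every point of (Δφ₊)^{−1}(0). Let u be the unique continuous periodic solution of the double obstacle problem, with contact sets M₋(u) = {u = φ₋} and M₊(u) = {u = φ₊}. Then the free boundaries ∂M₋(u) and ∂M₊(u) have Lebesgue measure zero. -/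
open MeasureTheory Real

noncomputable section

/-- Euclidean space `ℝ^d`. -/
abbrev Rd (d : ℕ) := EuclideanSpace ℝ (Fin d)

/-- `f : ℝ^d → α` is `(2πℤ)^d`-periodic. -/
def PeriodicRd {d : ℕ} {α : Type*} (f : Rd d → α) : Prop :=
  ∀ (x : Rd d) (j : Fin d),
    f (x + (2 * Real.pi) • EuclideanSpace.single j (1 : ℝ)) = f x

/-- The Euclidean Laplacian `Δ = ∑ ∂²/∂xⱼ²`. -/
noncomputable def lapRd {d : ℕ} (f : Rd d → ℝ) (x : Rd d) : ℝ :=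
  ∑ j : Fin d,
    fderiv ℝ (fun y => fderiv ℝ f y (EuclideanSpace.single j (1 : ℝ))) x
      (EuclideanSpace.single j (1 : ℝ))

/-- The fundamental domain `E = [0,2π)^d`. -/
def EfdR (d : ℕ) : Set (Rd d) := {x | ∀ j : Fin d, x j ∈ Set.Ico 0 (2 * Real.pi)}

/-- `u` is a solution of the double obstacle problem with obstacles `φ₋ ≤ u ≤ φ₊`:
`u` is continuous, periodic, trapped between the obstacles, distributionally
subharmonic on `{u > φ₋}` and distributionally superharmonic on `{u < φ₊}`. -/
def IsDOPSolution {d : ℕ} (φm φp u : Rd d → ℝ) : Prop :=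
  Continuous u ∧ PeriodicRd u ∧ (∀ x, φm x ≤ u x ∧ u x ≤ φp x) ∧
    (∀ χ : Rd d → ℝ, ContDiff ℝ (⊤ : ℕ∞) χ → HasCompactSupport χ → (∀ x, 0 ≤ χ x) →
      tsupport χ ⊆ {x | φm x < u x} → 0 ≤ ∫ x : Rd d, u x * lapRd χ x) ∧
    (∀ χ : Rd d → ℝ, ContDiff ℝ (⊤ : ℕ∞) χ → HasCompactSupport χ → (∀ x, 0 ≤ χ x) →
      tsupport χ ⊆ {x | u x < φp x} → (∫ x : Rd d, u x * lapRd χ x) ≤ 0)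

open Filter Topology Metric
open scoped ContDiff

/-! ### The Laplacian -/

lemma lapRd_comp_mul_norm_sq {d : ℕ} {G G₁ G₂ : ℝ → ℝ} (h₁ : ∀ t, HasDerivAt G (G₁ t) t)
    (h₂ : ∀ t, HasDerivAt G₁ (G₂ t) t) (k : ℝ) (y x : Rd d) :
    lapRd (fun x => G (k * ‖x - y‖ ^ 2)) x =
      k * (2 * d * G₁ (k * ‖x - y‖ ^ 2) + 4 * (k * ‖x - y‖ ^ 2) * G₂ (k * ‖x - y‖ ^ 2)) := by
  have hN : ∀ x : Rd d, HasFDerivAt (fun x : Rd d => k * ‖x - y‖ ^ 2)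
      (k • (2 • (innerSL ℝ (x - y)).comp (ContinuousLinearMap.id ℝ (Rd d)))) x := fun x =>
    (((hasFDerivAt_id x).sub_const y).norm_sq).const_mul k
  have hfst : ∀ (j : Fin d) (x : Rd d),
      fderiv ℝ (fun x => G (k * ‖x - y‖ ^ 2)) x (EuclideanSpace.single j (1 : ℝ)) =
        G₁ (k * ‖x - y‖ ^ 2) * (2 * k * (x j - y j)) := by
    intro j x
    have := ((h₁ _).comp_hasFDerivAt x (hN x)).fderiv
    simp only [Function.comp_def] at this
    rw [this]
    simp only [ContinuousLinearMap.comp_id, smul_apply, innerSL_apply_apply,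
      EuclideanSpace.inner_single_right, PiLp.sub_apply, smul_eq_mul, nsmul_eq_mul]
    simp only [conj_trivial, Nat.cast_ofNat]
    ring
  have hcoord : ∀ (j : Fin d) (x : Rd d), HasFDerivAt (fun x : Rd d => 2 * k * (x j - y j))
      ((2 * k) • (EuclideanSpace.proj j : Rd d →L[ℝ] ℝ)) x := fun j x =>
    (((EuclideanSpace.proj j : Rd d →L[ℝ] ℝ).hasFDerivAt (x := x)).sub_const (y j)).const_mul (2 * k)
  have hsnd : ∀ (j : Fin d),
      fderiv ℝ (fun x => fderiv ℝ (fun x => G (k * ‖x - y‖ ^ 2)) x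
        (EuclideanSpace.single j (1 : ℝ))) x (EuclideanSpace.single j (1 : ℝ)) =
        2 * k * G₁ (k * ‖x - y‖ ^ 2) + 4 * k ^ 2 * G₂ (k * ‖x - y‖ ^ 2) * (x j - y j) ^ 2 := by
    intro j
    simp only [hfst]
    have := (((h₂ _).comp_hasFDerivAt x (hN x)).mul (hcoord j x)).fderiv
    simp only [Function.comp_def, Pi.mul_def] at this
    rw [this]
    simp [EuclideanSpace.inner_single_right]
    ring
  have hnorm : ‖x - y‖ ^ 2 = ∑ j, (x j - y j) ^ 2 := by
    simp [EuclideanSpace.norm_sq_eq]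
  simp only [lapRd, hsnd, Finset.sum_add_distrib, ← Finset.mul_sum, ← hnorm]
  simp
  ring

lemma contDiff_fderiv_single {d : ℕ} {f : Rd d → ℝ} {m n : ℕ∞ω} (hf : ContDiff ℝ n f)
    (hmn : m + 1 ≤ n) (j : Fin d) :
    ContDiff ℝ m fun x => fderiv ℝ f x (EuclideanSpace.single j (1 : ℝ)) :=
  (hf.fderiv_right hmn).clm_apply contDiff_const

lemma contDiff_lapRd {d : ℕ} {f : Rd d → ℝ} {m n : ℕ∞ω} (hf : ContDiff ℝ n f)
    (hmn : m + 1 + 1 ≤ n) : ContDiff ℝ m (lapRd f) := by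
  unfold lapRd
  exact ContDiff.sum fun j _ =>
    contDiff_fderiv_single (contDiff_fderiv_single hf hmn j) le_rfl j

lemma continuous_lapRd {d : ℕ} {f : Rd d → ℝ} (hf : ContDiff ℝ 2 f) : Continuous (lapRd f) :=
  (contDiff_lapRd (m := 0) hf (by norm_num)).continuous

lemma lapRd_neg {d : ℕ} (f : Rd d → ℝ) : lapRd (-f) = -lapRd f := by
  funext x
  simp [lapRd, fderiv_neg, fderiv_fun_neg]

lemma lapRd_add {d : ℕ} {f g : Rd d → ℝ} (hf : ContDiff ℝ 2 f) (hg : ContDiff ℝ 2 g) (x : Rd d) :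
    lapRd (f + g) x = lapRd f x + lapRd g x := by
  have h : ∀ j : Fin d, (fun y => fderiv ℝ (f + g) y (EuclideanSpace.single j (1 : ℝ))) =
      (fun y => fderiv ℝ f y (EuclideanSpace.single j (1 : ℝ))) +
        fun y => fderiv ℝ g y (EuclideanSpace.single j (1 : ℝ)) := by
    intro j
    funext y
    simp [fderiv_add (hf.differentiable (by norm_num) y) (hg.differentiable (by norm_num) y)]
  have hd : ∀ {f : Rd d → ℝ}, ContDiff ℝ 2 f → ∀ j : Fin d,
      DifferentiableAt ℝ (fun y => fderiv ℝ f y (EuclideanSpace.single j (1 : ℝ))) x :=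
    fun hf j => (contDiff_fderiv_single (m := 1) hf (by norm_num) j).differentiable (by norm_num) x
  simp only [lapRd, h, fderiv_add (hd hf _) (hd hg _), add_apply,
    Finset.sum_add_distrib]

lemma HasCompactSupport.fderiv_single {d : ℕ} {χ : Rd d → ℝ} (hχ : HasCompactSupport χ)
    (j : Fin d) :
    HasCompactSupport fun x => fderiv ℝ χ x (EuclideanSpace.single j (1 : ℝ)) :=
  hχ.fderiv_apply ℝ _

lemma lapRd_eq_zero_of_notMem_tsupport {d : ℕ} {χ : Rd d → ℝ} {x : Rd d} (hx : x ∉ tsupport χ) :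
    lapRd χ x = 0 := by
  refine Finset.sum_eq_zero fun j _ => ?_
  refine image_eq_zero_of_notMem_tsupport (f := fun x => fderiv ℝ (fun y => fderiv ℝ χ y
    (EuclideanSpace.single j (1 : ℝ))) x (EuclideanSpace.single j (1 : ℝ))) fun hx' => hx ?_
  exact tsupport_fderiv_apply_subset ℝ _ (tsupport_fderiv_apply_subset ℝ _ hx')

lemma HasCompactSupport.lapRd {d : ℕ} {χ : Rd d → ℝ} (hχ : HasCompactSupport χ) :
    HasCompactSupport (lapRd χ) :=
  hχ.mono' fun _ hx => by_contra fun hxs => hx (lapRd_eq_zero_of_notMem_tsupport hxs)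

/-- The second Green identity against a compactly supported function. -/
lemma integral_mul_lapRd_comm {d : ℕ} {φ χ : Rd d → ℝ} (hφ : ContDiff ℝ 2 φ) (hχ : ContDiff ℝ 2 χ)
    (hχc : HasCompactSupport χ) :
    ∫ x, φ x * lapRd χ x = ∫ x, lapRd φ x * χ x := by
  have hmul : ∀ {f g : Rd d → ℝ}, Continuous f → Continuous g → HasCompactSupport g →
      Integrable fun x => f x * g x := fun hf hg hgc =>
    (hf.mul hg).integrable_of_hasCompactSupport hgc.mul_left
  have hd1 : ∀ {f : Rd d → ℝ}, ContDiff ℝ 2 f → ∀ j : Fin d,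
      ContDiff ℝ 1 (fun y => fderiv ℝ f y (EuclideanSpace.single j (1 : ℝ))) :=
    fun hf j => contDiff_fderiv_single hf (by norm_num) j
  have hd2 : ∀ {f : Rd d → ℝ}, ContDiff ℝ 2 f → ∀ j : Fin d,
      Continuous (fun x => fderiv ℝ (fun y => fderiv ℝ f y (EuclideanSpace.single j (1 : ℝ))) x
        (EuclideanSpace.single j (1 : ℝ))) :=
    fun hf j => (contDiff_fderiv_single (m := 0) (hd1 hf j) (by norm_num) j).continuous
  simp only [lapRd, Finset.mul_sum, Finset.sum_mul]
  rw [integral_finsetSum _ fun j _ => hmul hφ.continuous (hd2 hχ j)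
      ((hχc.fderiv_single j).fderiv_single j),
    integral_finsetSum _ fun j _ => hmul (hd2 hφ j) hχ.continuous hχc]
  refine Finset.sum_congr rfl fun j _ => ?_
  rw [integral_mul_fderiv_eq_neg_fderiv_mul_of_integrable
      (hmul (hd1 hφ j).continuous (hd1 hχ j).continuous (hχc.fderiv_single j))
      (hmul hφ.continuous (hd2 hχ j) ((hχc.fderiv_single j).fderiv_single j))
      (hmul hφ.continuous (hd1 hχ j).continuous (hχc.fderiv_single j))
      (fun x _ => hφ.differentiable (by norm_num) x)
      (fun x _ => (hd1 hχ j).differentiable (by norm_num) x),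
    integral_mul_fderiv_eq_neg_fderiv_mul_of_integrable
      (hmul (hd2 hφ j) hχ.continuous hχc)
      (hmul (hd1 hφ j).continuous (hd1 hχ j).continuous (hχc.fderiv_single j))
      (hmul (hd1 hφ j).continuous hχ.continuous hχc)
      (fun x _ => (hd1 hφ j).differentiable (by norm_num) x)
      (fun x _ => hχ.differentiable (by norm_num) x), neg_neg]

/-! ### Porous sets -/

/-- A set that is porous at each of its points is Lebesgue-null. -/
lemma volume_eq_zero_of_porous {d : ℕ} {S : Set (Rd d)}
    (hS : ∀ x ∈ S, ∃ δ > 0, ∀ᶠ r in 𝓝[>] (0 : ℝ), ∃ y, dist y x ≤ r ∧ Disjoint S (ball y (δ * r))) :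
    volume S = 0 := by
  have key : ∀ᵐ x ∂(volume.restrict S), x ∉ S := by
    filter_upwards [Besicovitch.ae_tendsto_measure_inter_div volume S] with x hx hxS
    obtain ⟨δ, hδ, hr⟩ := hS x hxS
    set θ : ℝ := (δ / (1 + δ)) ^ d with hθ
    have hθ0 : 0 < θ := by positivity
    have hlim : Tendsto (fun r : ℝ => volume (S ∩ closedBall x ((1 + δ) * r)) /
        volume (closedBall x ((1 + δ) * r))) (𝓝[>] 0) (𝓝 1) := by
      refine hx.comp (tendsto_nhdsWithin_iff.2 ⟨?_, ?_⟩)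
      · have : Tendsto (fun r : ℝ => (1 + δ) * r) (𝓝 0) (𝓝 ((1 + δ) * 0)) :=
          tendsto_id.const_mul _
        rw [mul_zero] at this
        exact this.mono_left nhdsWithin_le_nhds
      · filter_upwards [self_mem_nhdsWithin] with r hr
        exact mul_pos (by positivity : 0 < 1 + δ) hr
    have hle : ∀ᶠ r : ℝ in 𝓝[>] 0, volume (S ∩ closedBall x ((1 + δ) * r)) /
        volume (closedBall x ((1 + δ) * r)) ≤ 1 - ENNReal.ofReal θ := by
      filter_upwards [hr, self_mem_nhdsWithin] with r ⟨y, hyx, hdisj⟩ hr0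
      have hr0 : 0 < r := hr0
      have hsub : ball y (δ * r) ⊆ closedBall x ((1 + δ) * r) := by
        intro z hz
        have := dist_triangle z y x
        rw [mem_ball] at hz
        rw [mem_closedBall]
        nlinarith
      have hR : 0 < (1 + δ) * r := by positivity
      have hV0 : volume (closedBall x ((1 + δ) * r)) ≠ 0 := (measure_closedBall_pos _ _ hR).ne'
      have hVt : volume (closedBall x ((1 + δ) * r)) ≠ ⊤ := measure_closedBall_lt_top.ne
      have hB : volume (ball y (δ * r)) =
          ENNReal.ofReal θ * volume (closedBall x ((1 + δ) * r)) := by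
        rw [Measure.addHaar_ball_of_pos _ _ (by positivity), Measure.addHaar_closedBall _ _ hR.le,
          ← mul_assoc, ← ENNReal.ofReal_mul hθ0.le]
        congr 2
        simp only [finrank_euclideanSpace, Fintype.card_fin, hθ, ← mul_pow]
        congr 1
        field_simp
      rw [ENNReal.div_le_iff hV0 hVt, ENNReal.sub_mul (fun _ _ => hVt), one_mul, ← hB,
        ← measure_sdiff hsub measurableSet_ball.nullMeasurableSet measure_ball_lt_top.ne]
      exact measure_mono fun z hz => ⟨hz.2, fun hzb => hdisj.le_bot ⟨hz.1, hzb⟩⟩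
    have h1 := le_of_tendsto hlim hle
    have h2 : (1 : ENNReal) - ENNReal.ofReal θ < 1 :=
      ENNReal.sub_lt_self ENNReal.one_ne_top one_ne_zero (by simpa using hθ0)
    exact absurd h1 h2.not_ge
  rw [ae_iff] at key
  simp only [not_not] at key
  simpa using le_antisymm ((Measure.le_restrict_apply S S).trans_eq key) bot_le

/-! ### A smooth radial averaging kernel -/

/-- A smooth cutoff on `ℝ` equal to `1` on `(-∞, 1/4]` and to `0` on `[1, ∞)`. -/
def cutoff (t : ℝ) : ℝ := Real.smoothTransition ((1 - t) * (4 / 3))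

/-- The compactly supported (on the right) function with derivative `-cutoff / 2`. -/
def cutoffTail (t : ℝ) : ℝ := -(2⁻¹ * ∫ τ in (1 : ℝ)..t, cutoff τ)

lemma cutoff_nonneg (t : ℝ) : 0 ≤ cutoff t := Real.smoothTransition.nonneg _

lemma cutoff_le_one (t : ℝ) : cutoff t ≤ 1 := Real.smoothTransition.le_one _

lemma cutoff_eq_one {t : ℝ} (ht : t ≤ 1 / 4) : cutoff t = 1 :=
  Real.smoothTransition.one_of_one_le (by linarith)

lemma cutoff_eq_zero {t : ℝ} (ht : 1 ≤ t) : cutoff t = 0 :=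
  Real.smoothTransition.zero_of_nonpos (by linarith)

lemma contDiff_cutoff : ContDiff ℝ ∞ cutoff :=
  Real.smoothTransition.contDiff.comp ((contDiff_const.sub contDiff_id).mul contDiff_const)

lemma hasDerivAt_cutoff (t : ℝ) : HasDerivAt cutoff (deriv cutoff t) t :=
  (contDiff_cutoff.differentiable (by simp) t).hasDerivAt

lemma hasDerivAt_cutoffTail (t : ℝ) : HasDerivAt cutoffTail (-(2⁻¹ * cutoff t)) t :=
  ((intervalIntegral.integral_hasDerivAt_right
    (contDiff_cutoff.continuous.intervalIntegrable _ _)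
    contDiff_cutoff.continuous.stronglyMeasurable.stronglyMeasurableAtFilter
    contDiff_cutoff.continuous.continuousAt).const_mul _).neg

lemma contDiff_cutoffTail : ContDiff ℝ ∞ cutoffTail := by
  rw [contDiff_infty_iff_deriv]
  refine ⟨fun t => (hasDerivAt_cutoffTail t).differentiableAt, ?_⟩
  rw [show deriv cutoffTail = fun t => -(2⁻¹ * cutoff t) from
    funext fun t => (hasDerivAt_cutoffTail t).deriv]
  exact (contDiff_const.mul contDiff_cutoff).neg

lemma cutoffTail_eq_zero {t : ℝ} (ht : 1 ≤ t) : cutoffTail t = 0 := by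
  have : ∫ τ in (1 : ℝ)..t, cutoff τ = 0 := by
    rw [intervalIntegral.integral_of_le ht]
    exact setIntegral_eq_zero_of_forall_eq_zero fun τ hτ => cutoff_eq_zero hτ.1.le
  simp [cutoffTail, this]

lemma cutoffTail_nonneg (t : ℝ) : 0 ≤ cutoffTail t := by
  have hanti : Antitone cutoffTail := antitone_of_deriv_nonpos
    (fun t => (hasDerivAt_cutoffTail t).differentiableAt) fun t => by
      rw [(hasDerivAt_cutoffTail t).deriv]
      linarith [cutoff_nonneg t]
  exact cutoffTail_eq_zero (le_max_right t 1) ▸ hanti (le_max_left t 1)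

/-- The total mass of the kernel `z ↦ cutoff ‖z‖²`. -/
def cutoffMass (d : ℕ) : ℝ := ∫ z : Rd d, cutoff (‖z‖ ^ 2)

/-- The total mass of the potential `z ↦ cutoffTail ‖z‖²`. -/
def tailMass (d : ℕ) : ℝ := ∫ z : Rd d, cutoffTail (‖z‖ ^ 2)

/-- The (unnormalised) average of `v` around `y` at scale `s`. -/
def cutoffMean {d : ℕ} (v : Rd d → ℝ) (y : Rd d) (s : ℝ) : ℝ :=
  ∫ z : Rd d, v (y + s • z) * cutoff (‖z‖ ^ 2)

lemma tsupport_radial_subset {d : ℕ} {h : ℝ → ℝ} (hh : ∀ t, 1 ≤ t → h t = 0) (y : Rd d) {s : ℝ}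
    (hs : 0 < s) : tsupport (fun x : Rd d => h ((s ^ 2)⁻¹ * ‖x - y‖ ^ 2)) ⊆ closedBall y s := by
  refine closure_minimal (fun x hx => ?_) isClosed_closedBall
  by_contra hxs
  refine hx (hh _ ?_)
  rw [mem_closedBall, dist_eq_norm, not_le] at hxs
  rw [inv_mul_eq_div, one_le_div (by positivity)]
  gcongr

lemma integrable_mul_radial {d : ℕ} {h : ℝ → ℝ} (hc : Continuous h) (hh : ∀ t, 1 ≤ t → h t = 0)
    {v : Rd d → ℝ} (hv : Continuous v) (y : Rd d) {s : ℝ} (hs : 0 < s) :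
    Integrable fun x : Rd d => v x * h ((s ^ 2)⁻¹ * ‖x - y‖ ^ 2) := by
  refine Continuous.integrable_of_hasCompactSupport (by fun_prop) (HasCompactSupport.mul_left ?_)
  exact (isCompact_closedBall y s).of_isClosed_subset (isClosed_tsupport _)
    (tsupport_radial_subset hh y hs)

lemma integrable_radial {d : ℕ} {h : ℝ → ℝ} (hc : Continuous h) (hh : ∀ t, 1 ≤ t → h t = 0)
    {v : Rd d → ℝ} (hv : Continuous v) : Integrable fun z : Rd d => v z * h (‖z‖ ^ 2) := by
  simpa using integrable_mul_radial hc hh hv 0 one_pos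

lemma integral_radial_scale {d : ℕ} (v : Rd d → ℝ) (h : ℝ → ℝ) (y : Rd d) {s : ℝ} (hs : 0 < s) :
    (s ^ d)⁻¹ * ∫ x, v x * h ((s ^ 2)⁻¹ * ‖x - y‖ ^ 2) = ∫ z, v (y + s • z) * h (‖z‖ ^ 2) := by
  have h1 := Measure.integral_comp_smul (volume : Measure (Rd d))
    (fun z => v (y + z) * h ((s ^ 2)⁻¹ * ‖z‖ ^ 2)) s
  have h2 := integral_add_left_eq_self (μ := (volume : Measure (Rd d)))
    (fun x => v x * h ((s ^ 2)⁻¹ * ‖x - y‖ ^ 2)) y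
  simp only [add_sub_cancel_left] at h2
  rw [h2, finrank_euclideanSpace, Fintype.card_fin, abs_of_pos (by positivity), smul_eq_mul] at h1
  rw [← h1]
  congr 1
  funext z
  rw [norm_smul, Real.norm_of_nonneg hs.le, mul_pow, inv_mul_cancel_left₀ (by positivity)]

lemma integral_radial_pos {d : ℕ} {h : ℝ → ℝ} (hc : Continuous h) (hh : ∀ t, 1 ≤ t → h t = 0)
    (h0 : ∀ t, 0 ≤ h t) (hpos : h 0 ≠ 0) : 0 < ∫ z : Rd d, h (‖z‖ ^ 2) := by
  refine Continuous.integral_pos_of_hasCompactSupport_nonneg_nonzero (x := (0 : Rd d))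
    (by fun_prop) ?_ (fun z => h0 _) (by simpa using hpos)
  have := tsupport_radial_subset (d := d) hh 0 one_pos
  simp only [one_pow, inv_one, one_mul, sub_zero] at this
  exact (isCompact_closedBall (0 : Rd d) 1).of_isClosed_subset (isClosed_tsupport _) this

lemma cutoffMass_pos (d : ℕ) : 0 < cutoffMass d :=
  integral_radial_pos contDiff_cutoff.continuous (fun _ => cutoff_eq_zero) cutoff_nonneg
    (by simp [cutoff_eq_one])

lemma tailMass_pos (d : ℕ) : 0 < tailMass d := by
  refine integral_radial_pos contDiff_cutoffTail.continuous (fun _ => cutoffTail_eq_zero)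
    cutoffTail_nonneg (ne_of_gt ?_)
  have h : 0 < ∫ τ in (0 : ℝ)..1, cutoff τ := intervalIntegral.intervalIntegral_pos_of_pos_on
    (contDiff_cutoff.continuous.intervalIntegrable _ _)
    (fun t ht => Real.smoothTransition.pos_of_pos (by linarith [ht.2])) one_pos
  rw [cutoffTail, intervalIntegral.integral_symm]
  linarith

lemma cutoffMean_mono {d : ℕ} {v : Rd d → ℝ} (hv : Continuous v) {y : Rd d} {s b : ℝ}
    (h : ∀ z : Rd d, ‖z‖ ≤ 1 → v (y + s • z) ≤ b) : cutoffMean v y s ≤ b * cutoffMass d := by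
  rw [cutoffMass, ← integral_const_mul]
  refine integral_mono (integrable_radial (v := fun z => v (y + s • z)) contDiff_cutoff.continuous
    (fun _ => cutoff_eq_zero) (by fun_prop)) (integrable_radial (v := fun _ => b)
      contDiff_cutoff.continuous (fun _ => cutoff_eq_zero) continuous_const) fun z => ?_
  rcases le_total ‖z‖ 1 with hz | hz
  · exact mul_le_mul_of_nonneg_right (h z hz) (cutoff_nonneg _)
  · simp [cutoff_eq_zero (one_le_pow₀ hz : 1 ≤ ‖z‖ ^ 2)]

lemma cutoffMean_neg {d : ℕ} (v : Rd d → ℝ) (y : Rd d) (s : ℝ) :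
    cutoffMean (-v) y s = -cutoffMean v y s := by
  simp [cutoffMean, integral_neg]

/-- Averages of a nonnegative function over a small ball are controlled by averages over a
larger ball containing it. -/
lemma cutoffMean_le_cutoffMean {d : ℕ} {v : Rd d → ℝ} (hv : Continuous v) (h0 : ∀ x, 0 ≤ v x)
    {y z : Rd d} {s S : ℝ} (hs : 0 < s) (hS : 0 < S) (hyz : dist y z + s ≤ S / 2) :
    cutoffMean v y s ≤ (S / s) ^ d * cutoffMean v z S := by
  have hc := contDiff_cutoff.continuous
  rw [cutoffMean, cutoffMean, ← integral_radial_scale v cutoff y hs,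
    ← integral_radial_scale v cutoff z hS]
  have hmul : ∫ x, v x * cutoff ((s ^ 2)⁻¹ * ‖x - y‖ ^ 2) ≤
      ∫ x, v x * cutoff ((S ^ 2)⁻¹ * ‖x - z‖ ^ 2) := by
    refine integral_mono (integrable_mul_radial hc (fun _ => cutoff_eq_zero) hv y hs)
      (integrable_mul_radial hc (fun _ => cutoff_eq_zero) hv z hS) fun x => ?_
    refine mul_le_mul_of_nonneg_left ?_ (h0 x)
    rcases le_total ‖x - y‖ s with hx | hx
    · rw [cutoff_eq_one (t := (S ^ 2)⁻¹ * ‖x - z‖ ^ 2)]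
      · exact cutoff_le_one _
      · have h1 : ‖x - z‖ ≤ S / 2 := by
          have := dist_triangle x y z
          rw [dist_eq_norm, dist_eq_norm x y] at this
          linarith
        rw [inv_mul_eq_div, div_le_iff₀ (by positivity)]
        nlinarith [norm_nonneg (x - z)]
    · rw [cutoff_eq_zero]
      · exact cutoff_nonneg _
      · rw [inv_mul_eq_div, one_le_div (by positivity)]
        gcongr
  calc _ ≤ (s ^ d)⁻¹ * ∫ x, v x * cutoff ((S ^ 2)⁻¹ * ‖x - z‖ ^ 2) := by gcongr
    _ = _ := by
      rw [div_pow]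
      field_simp

lemma continuous_cutoffMean {d : ℕ} {v : Rd d → ℝ} (hv : Continuous v) (y : Rd d) :
    Continuous (cutoffMean v y) := by
  have : cutoffMean v y = fun s => ∫ z in closedBall (0 : Rd d) 1,
      v (y + s • z) * cutoff (‖z‖ ^ 2) := by
    funext s
    refine (setIntegral_eq_integral_of_forall_compl_eq_zero fun z hz => ?_).symm
    rw [mem_closedBall_zero_iff, not_le] at hz
    simp [cutoff_eq_zero (one_le_pow₀ hz.le : 1 ≤ ‖z‖ ^ 2)]
  rw [this]
  have hc := contDiff_cutoff.continuous
  exact continuous_parametric_integral_of_continuous (by fun_prop) (isCompact_closedBall _ _)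

lemma lapRd_cutoffTail {d : ℕ} (y x : Rd d) (s : ℝ) :
    lapRd (fun x => cutoffTail ((s ^ 2)⁻¹ * ‖x - y‖ ^ 2)) x =
      -((s ^ 2)⁻¹ * (d * cutoff ((s ^ 2)⁻¹ * ‖x - y‖ ^ 2) +
        2 * ((s ^ 2)⁻¹ * ‖x - y‖ ^ 2) * deriv cutoff ((s ^ 2)⁻¹ * ‖x - y‖ ^ 2))) := by
  rw [lapRd_comp_mul_norm_sq hasDerivAt_cutoffTail
    (fun t => ((hasDerivAt_cutoff t).const_mul 2⁻¹).neg)]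
  ring

/-- The scaled kernel evolves in the scale by the Laplacian of the scaled potential. -/
lemma hasDerivAt_scaled_cutoff {d : ℕ} (y x : Rd d) {s : ℝ} (hs : 0 < s) :
    HasDerivAt (fun s : ℝ => (s ^ d)⁻¹ * cutoff ((s ^ 2)⁻¹ * ‖x - y‖ ^ 2))
      (s * (s ^ d)⁻¹ * lapRd (fun x => cutoffTail ((s ^ 2)⁻¹ * ‖x - y‖ ^ 2)) x) s := by
  have hpow : HasDerivAt (fun s : ℝ => s ^ d) (d * s ^ d / s) s := by
    refine (hasDerivAt_pow d s).congr_deriv ?_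
    rcases d with _ | n
    · simp
    · rw [pow_succ]
      simp
      field_simp
  have h1 := hpow.fun_inv (by positivity)
  have h2 := ((hasDerivAt_pow 2 s).fun_inv (by positivity)).mul_const (‖x - y‖ ^ 2)
  have h3 := h1.fun_mul ((hasDerivAt_cutoff _).comp s h2)
  refine h3.congr_deriv ?_
  rw [lapRd_cutoffTail]
  simp only [Function.comp_apply]
  field_simp
  ring

lemma hasDerivAt_cutoffMean {d : ℕ} {v : Rd d → ℝ} (hv : Continuous v) (y : Rd d) {s : ℝ}
    (hs : 0 < s) :
    HasDerivAt (cutoffMean v y)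
      (s * (s ^ d)⁻¹ * ∫ x, v x * lapRd (fun x => cutoffTail ((s ^ 2)⁻¹ * ‖x - y‖ ^ 2)) x) s := by
  have hc := contDiff_cutoff.continuous
  have hc' : Continuous (deriv cutoff) := contDiff_cutoff.continuous_deriv (by simp)
  set F : ℝ → Rd d → ℝ := fun s x => v x * ((s ^ d)⁻¹ * cutoff ((s ^ 2)⁻¹ * ‖x - y‖ ^ 2)) with hF
  set F' : ℝ → Rd d → ℝ := fun s x =>
    v x * (s * (s ^ d)⁻¹ * lapRd (fun x => cutoffTail ((s ^ 2)⁻¹ * ‖x - y‖ ^ 2)) x) with hF'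
  have hcont : ContinuousOn (fun p : ℝ × Rd d => F' p.1 p.2)
      (Set.Icc (s / 2) (2 * s) ×ˢ closedBall y (2 * s)) := by
    simp only [hF', lapRd_cutoffTail]
    have hne : ∀ p ∈ Set.Icc (s / 2) (2 * s) ×ˢ closedBall y (2 * s), ∀ n : ℕ, p.1 ^ n ≠ 0 :=
      fun p hp n => by
        have : 0 < p.1 := lt_of_lt_of_le (by positivity) hp.1.1
        positivity
    have hk : ContinuousOn (fun p : ℝ × Rd d => (p.1 ^ 2)⁻¹)
      (Set.Icc (s / 2) (2 * s) ×ˢ closedBall y (2 * s)) :=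
        ContinuousOn.inv₀ (by fun_prop) fun p hp => hne p hp 2
    have hk' : ContinuousOn (fun p : ℝ × Rd d => (p.1 ^ d)⁻¹)
      (Set.Icc (s / 2) (2 * s) ×ˢ closedBall y (2 * s)) :=
        ContinuousOn.inv₀ (by fun_prop) fun p hp => hne p hp d
    have hτ : ContinuousOn (fun p : ℝ × Rd d => (p.1 ^ 2)⁻¹ * ‖p.2 - y‖ ^ 2)
      (Set.Icc (s / 2) (2 * s) ×ˢ closedBall y (2 * s)) := hk.mul (by fun_prop)
    have h1 := hc.comp_continuousOn hτ
    have h2 := hc'.comp_continuousOn hτ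
    exact (hv.comp_continuousOn continuousOn_snd).mul ((continuousOn_fst.mul hk').mul
      ((hk.mul ((continuousOn_const.mul h1).add ((continuousOn_const.mul hτ).mul h2))).neg))
  obtain ⟨C, hC⟩ := (isCompact_Icc.prod (isCompact_closedBall y (2 * s))).exists_bound_of_continuousOn
    hcont
  have hd := hasDerivAt_integral_of_dominated_loc_of_deriv_le (μ := volume) (F := F) (F' := F')
    (bound := (closedBall y (2 * s)).indicator fun _ => C) (x₀ := s)
    (s := Set.Icc (s / 2) (2 * s)) (Icc_mem_nhds (by linarith) (by linarith))
    (Eventually.of_forall fun r => (Continuous.aestronglyMeasurable (by fun_prop)))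
    ?_ ?_ ?_ ?_ ?_
  · have heq : cutoffMean v y =ᶠ[𝓝 s] fun s => ∫ x, F s x := by
      filter_upwards [lt_mem_nhds hs] with r hr
      rw [cutoffMean, ← integral_radial_scale v cutoff y hr, ← integral_const_mul]
      congr 1
      funext x
      simp only [hF]
      ring
    refine (hd.2.congr_of_eventuallyEq heq).congr_deriv ?_
    rw [← integral_const_mul]
    congr 1
    funext x
    simp only [hF']
    ring
  · have := (integrable_mul_radial hc (fun _ => cutoff_eq_zero) hv y hs).const_mul (s ^ d)⁻¹
    refine this.congr (Eventually.of_forall fun x => ?_)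
    simp only [hF]
    ring
  · refine Continuous.aestronglyMeasurable ?_
    simp only [hF', lapRd_cutoffTail]
    fun_prop
  · refine Eventually.of_forall fun x r hr => ?_
    by_cases hx : x ∈ closedBall y (2 * s)
    · rw [Set.indicator_of_mem hx]
      exact hC (r, x) ⟨hr, hx⟩
    · rw [Set.indicator_of_notMem hx]
      have hr0 : 0 < r := lt_of_lt_of_le (by positivity) hr.1
      have hx' : x ∉ closedBall y r := fun h => hx (closedBall_subset_closedBall hr.2 h)
      have : x ∉ tsupport (fun x => cutoffTail ((r ^ 2)⁻¹ * ‖x - y‖ ^ 2)) := fun h =>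
        hx' (tsupport_radial_subset (fun _ => cutoffTail_eq_zero) y hr0 h)
      simp [hF', lapRd_eq_zero_of_notMem_tsupport this]
  · exact (integrable_indicator_iff measurableSet_closedBall).2
      (integrableOn_const measure_closedBall_lt_top.ne)
  · refine Eventually.of_forall fun x r hr => ?_
    exact (hasDerivAt_scaled_cutoff y x (lt_of_lt_of_le (by positivity) hr.1)).const_mul (v x)

/-- The weak mean value inequality: if `Δv ≥ a` in the sense of distributions on `ball y R`, then
averages of `v` around `y` exceed `v y` by the corresponding quadratic amount. -/
lemma le_cutoffMean {d : ℕ} {v : Rd d → ℝ} (hv : Continuous v) {y : Rd d} {R a : ℝ}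
    (h : ∀ χ : Rd d → ℝ, ContDiff ℝ ∞ χ → HasCompactSupport χ → (∀ x, 0 ≤ χ x) →
      tsupport χ ⊆ ball y R → a * ∫ x, χ x ≤ ∫ x, v x * lapRd χ x)
    {s : ℝ} (hs : 0 < s) (hsR : s ≤ R) :
    v y * cutoffMass d + a * tailMass d * (s ^ 2 / 2) ≤ cutoffMean v y s := by
  have hder : ∀ r ∈ Set.Ioo 0 s, 0 ≤ deriv (fun r =>
      cutoffMean v y r - a * tailMass d * (r ^ 2 / 2)) r := by
    intro r hr
    have hr0 : 0 < r := hr.1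
    have h1 := (hasDerivAt_cutoffMean hv y hr0).sub
      (((hasDerivAt_pow 2 r).div_const 2).const_mul (a * tailMass d))
    have h2 := h1.deriv
    simp only [Pi.sub_def] at h2
    rw [h2]
    have hts := tsupport_radial_subset (d := d) (fun _ => cutoffTail_eq_zero) y hr0
    have h3 := h _ (contDiff_cutoffTail.comp (contDiff_const.mul
      ((contDiff_id.sub contDiff_const).norm_sq ℝ)))
      ((isCompact_closedBall y r).of_isClosed_subset (isClosed_tsupport _) hts)
      (fun x => cutoffTail_nonneg _) (hts.trans (closedBall_subset_ball (hr.2.trans_le hsR)))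
    have h4 := integral_radial_scale (fun _ => 1) cutoffTail y hr0
    simp only [one_mul] at h4
    have h5 := mul_le_mul_of_nonneg_left h3 (by positivity : 0 ≤ r * (r ^ d)⁻¹)
    have h6 : r * (r ^ d)⁻¹ * (a * ∫ x, cutoffTail ((r ^ 2)⁻¹ * ‖x - y‖ ^ 2)) =
        r * a * tailMass d := by
      rw [tailMass, ← h4]
      ring
    simp only [Function.comp_def, id] at h5
    rw [h6] at h5
    simp only [Nat.cast_ofNat]
    linarith
  have hcont : ContinuousOn (fun r => cutoffMean v y r - a * tailMass d * (r ^ 2 / 2))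
      (Set.Icc 0 s) := ((continuous_cutoffMean hv y).sub (by fun_prop)).continuousOn
  have hmono := monotoneOn_of_deriv_nonneg (convex_Icc 0 s) hcont
    (fun r hr => by
      rw [interior_Icc] at hr
      exact ((hasDerivAt_cutoffMean hv y hr.1).sub (((hasDerivAt_pow 2 r).div_const 2).const_mul
        (a * tailMass d))).differentiableAt.differentiableWithinAt)
    (by rw [interior_Icc]; exact hder) (Set.left_mem_Icc.2 hs.le) (Set.right_mem_Icc.2 hs.le) hs.le
  have h0 : cutoffMean v y 0 = v y * cutoffMass d := by
    simp [cutoffMean, cutoffMass, integral_const_mul]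
  simp only [h0] at hmono
  linarith

/-! ### The contact set -/

/-- The continuous function `u` satisfies `0 ≤ Δu` on `U` in the sense of distributions. -/
def WeaklySubharmonicOn {d : ℕ} (u : Rd d → ℝ) (U : Set (Rd d)) : Prop :=
  ∀ χ : Rd d → ℝ, ContDiff ℝ ∞ χ → HasCompactSupport χ → (∀ x, 0 ≤ χ x) →
    tsupport χ ⊆ U → 0 ≤ ∫ x, u x * lapRd χ x

lemma WeaklySubharmonicOn.mono {d : ℕ} {u : Rd d → ℝ} {U V : Set (Rd d)}
    (h : WeaklySubharmonicOn u V) (hUV : U ⊆ V) : WeaklySubharmonicOn u U :=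
  fun χ h1 h2 h3 h4 => h χ h1 h2 h3 (h4.trans hUV)

lemma WeaklySubharmonicOn.le_cutoffMean_sub {d : ℕ} {u φ : Rd d → ℝ} {y : Rd d} {R a s : ℝ}
    (h : WeaklySubharmonicOn u (ball y R)) (hu : Continuous u) (hφ : ContDiff ℝ 2 φ)
    (ha : ∀ x ∈ ball y R, a ≤ -lapRd φ x) (hs : 0 < s) (hsR : s ≤ R) :
    (u y - φ y) * cutoffMass d + a * tailMass d * (s ^ 2 / 2) ≤ cutoffMean (u - φ) y s := by
  refine le_cutoffMean (v := u - φ) (hu.sub hφ.continuous) (fun χ h1 h2 h3 h4 => ?_) hs hsR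
  have hχ2 : ContDiff ℝ 2 χ := h1.of_le (by norm_cast)
  have hmul : ∀ {f : Rd d → ℝ}, Continuous f → Integrable fun x => f x * lapRd χ x := fun hf =>
    (hf.mul (continuous_lapRd hχ2)).integrable_of_hasCompactSupport h2.lapRd.mul_left
  have h5 : ∫ x, (u - φ) x * lapRd χ x = (∫ x, u x * lapRd χ x) - ∫ x, lapRd φ x * χ x := by
    rw [← integral_mul_lapRd_comm hφ hχ2 h2, ← integral_sub (hmul hu) (hmul hφ.continuous)]
    simp only [Pi.sub_apply, sub_mul]
  have hmul1 : Integrable fun x => lapRd φ x * χ x :=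
    ((continuous_lapRd hφ).mul h1.continuous).integrable_of_hasCompactSupport h2.mul_left
  have h6 : a * ∫ x, χ x ≤ -∫ x, lapRd φ x * χ x := by
    rw [← integral_const_mul, ← integral_neg]
    refine integral_mono ((h1.continuous.integrable_of_hasCompactSupport h2).const_mul a) hmul1.neg
      fun x => ?_
    by_cases hx : x ∈ tsupport χ
    · have := mul_le_mul_of_nonneg_right (ha x (h4 hx)) (h3 x)
      simpa using this
    · simp [image_eq_zero_of_notMem_tsupport hx]
  linarith [h χ h1 h2 h3 h4]

/-- An obstacle lying below a weakly superharmonic function is not strictly subharmonic at a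
contact point. -/
lemma lapRd_nonpos_of_contact {d : ℕ} {u φ : Rd d → ℝ} {U : Set (Rd d)} (hU : IsOpen U)
    (hu : Continuous u) (hφ : ContDiff ℝ 2 φ) (hle : ∀ x, φ x ≤ u x)
    (hsup : WeaklySubharmonicOn (-u) U) {x : Rd d} (hxU : x ∈ U) (hx : u x = φ x) :
    lapRd φ x ≤ 0 := by
  by_contra! hpos
  have hev : ∀ᶠ y in 𝓝 x, y ∈ U ∧ lapRd φ x / 2 < lapRd φ y :=
    (hU.eventually_mem hxU).and ((continuous_lapRd hφ).continuousAt.eventually_const_lt (by linarith))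
  obtain ⟨R, hR, hball⟩ := Metric.eventually_nhds_iff_ball.1 hev
  have h1 := (hsup.mono fun y hy => (hball y hy).1).le_cutoffMean_sub (a := lapRd φ x / 2)
    hu.neg hφ.neg (fun y hy => by
      have := (hball y hy).2
      rw [show (fun x => -φ x) = -φ from rfl, lapRd_neg]
      simpa using this.le) hR le_rfl
  have h2 : cutoffMean (-u - fun x => -φ x) x R ≤ 0 * cutoffMass d :=
    cutoffMean_mono (hu.neg.sub hφ.continuous.neg) fun z _ => by
      simpa using hle (x + R • z)
  have h3 : 0 < lapRd φ x / 2 * tailMass d * (R ^ 2 / 2) := by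
    have := tailMass_pos d
    positivity
  simp only [Pi.neg_apply, hx, sub_self, zero_mul] at h1 h2
  linarith

/-- Nondegeneracy: away from the contact set, `u - φ` grows at least quadratically. -/
lemma exists_quadratic_growth {d : ℕ} {u φ : Rd d → ℝ} (hu : Continuous u)
    (hφ : ContDiff ℝ 2 φ) (hsub : WeaklySubharmonicOn u {x | φ x < u x}) {x₁ : Rd d} {ρ c : ℝ}
    (hρ : 0 < ρ) (hc : 0 < c) (hx₁ : φ x₁ < u x₁)
    (hlap : ∀ x ∈ ball x₁ ρ, c ≤ -lapRd φ x) :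
    ∃ y, dist y x₁ = ρ ∧ c / (2 * d + 1) * ρ ^ 2 ≤ u y - φ y := by
  set k : ℝ := c / (2 * d + 1) with hk
  have hk0 : 0 < k := by positivity
  set q : Rd d → ℝ := fun x => k * ‖x - x₁‖ ^ 2 with hq
  have hqC : ContDiff ℝ 2 q := contDiff_const.mul ((contDiff_id.sub contDiff_const).norm_sq ℝ)
  have hqlap : ∀ x, lapRd q x = 2 * d * k := fun x => by
    have := lapRd_comp_mul_norm_sq (G := id) (G₁ := fun _ => 1) (G₂ := fun _ => 0) hasDerivAt_id
      (fun t => hasDerivAt_const t 1) k x₁ x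
    simp only [id] at this
    rw [hq, this]
    ring
  have hv : Continuous (u - (φ + q)) := hu.sub (hφ.continuous.add hqC.continuous)
  obtain ⟨y, hy, hmax⟩ := (isCompact_closedBall x₁ ρ).exists_isMaxOn
    ⟨x₁, mem_closedBall_self hρ.le⟩ hv.continuousOn
  have h1 : u x₁ - φ x₁ ≤ u y - φ y - k * ‖y - x₁‖ ^ 2 := by
    have h : (u - (φ + q)) x₁ ≤ (u - (φ + q)) y := hmax (mem_closedBall_self hρ.le)
    simp only [Pi.sub_apply, Pi.add_apply, hq, sub_self, norm_zero] at h
    linarith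
  have hy0 : φ y < u y := by
    have : 0 ≤ k * ‖y - x₁‖ ^ 2 := by positivity
    linarith
  have hyρ : dist y x₁ = ρ := by
    refine le_antisymm hy (not_lt.1 fun hlt => ?_)
    have hev : ∀ᶠ x in 𝓝 y, φ x < u x ∧ x ∈ ball x₁ ρ :=
      (hφ.continuous.continuousAt.eventually_lt hu.continuousAt hy0).and
        (isOpen_ball.mem_nhds hlt)
    obtain ⟨R, hR, hball⟩ := Metric.eventually_nhds_iff_ball.1 hev
    have h2 := (hsub.mono fun x hx => (hball x hx).1).le_cutoffMean_sub (a := k) (s := R / 2) hu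
      (hφ.add hqC) (fun x hx => by
        have h3 := hlap x (hball x hx).2
        have h4 : c = 2 * d * k + k := by
          rw [hk]
          field_simp
        have h5 := lapRd_add hφ hqC x
        rw [hqlap] at h5
        change k ≤ -lapRd (φ + q) x
        linarith) (by positivity) (by linarith)
    have h3 := cutoffMean_mono hv (y := y) (s := R / 2) (b := (u - (φ + q)) y) fun z hz => by
      refine hmax (ball_subset_closedBall (hball _ ?_).2)
      rw [mem_ball, dist_eq_norm, add_sub_cancel_left, norm_smul, Real.norm_of_nonneg (by positivity)]
      nlinarith
    have h4 : 0 < k * tailMass d * ((R / 2) ^ 2 / 2) := by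
      have := tailMass_pos d
      positivity
    change (u - (φ + q)) y * cutoffMass d + _ ≤ cutoffMean (u - (φ + q)) y (R / 2) at h2
    linarith
  refine ⟨y, hyρ, ?_⟩
  rw [← dist_eq_norm, hyρ] at h1
  linarith

/-- Optimal growth: `u - φ` is controlled by the squared distance to a nearest contact point. -/
lemma sub_le_sq_dist_contact {d : ℕ} {u φ : Rd d → ℝ} (hu : Continuous u)
    (hφ : ContDiff ℝ 2 φ) (hle : ∀ x, φ x ≤ u x)
    (hsub : WeaklySubharmonicOn u {x | φ x < u x}) {y z : Rd d} {ρ C : ℝ}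
    (hρ : 0 < ρ) (hyz : dist y z = ρ) (hz : u z = φ z)
    (hball : ∀ x ∈ ball y ρ, φ x < u x) (hlapy : ∀ x ∈ ball y ρ, lapRd φ x ≤ 0)
    (hsup : WeaklySubharmonicOn (-u) (ball z (4 * ρ)))
    (hlapz : ∀ x ∈ ball z (4 * ρ), -lapRd φ x ≤ C) :
    (u y - φ y) * cutoffMass d ≤ 8 ^ d * (C * tailMass d * 8) * ρ ^ 2 := by
  have h1 := (hsub.mono hball).le_cutoffMean_sub (a := 0) (s := ρ / 2) hu hφ
    (fun x hx => by linarith [hlapy x hx]) (by positivity) (by linarith)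
  have h2 := hsup.le_cutoffMean_sub (φ := -φ) (a := -C) (s := 4 * ρ) hu.neg hφ.neg
    (fun x hx => by
      rw [lapRd_neg]
      simpa using neg_le_neg (hlapz x hx)) (by positivity) le_rfl
  rw [show -u - -φ = -(u - φ) by abel, cutoffMean_neg] at h2
  have h3 := cutoffMean_le_cutoffMean (v := u - φ) (hu.sub hφ.continuous)
    (fun x => by simpa using hle x) (y := y) (z := z) (s := ρ / 2) (S := 4 * ρ) (by positivity)
    (by positivity) (by linarith)
  have h4 : cutoffMean (u - φ) z (4 * ρ) ≤ C * tailMass d * 8 * ρ ^ 2 := by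
    simp only [Pi.neg_apply, hz, sub_self, zero_mul] at h2
    linarith
  rw [show 4 * ρ / (ρ / 2) = 8 by field_simp; norm_num] at h3
  have h5 := mul_le_mul_of_nonneg_left h4 (by positivity : (0 : ℝ) ≤ 8 ^ d)
  linarith

/-- The contact set is porous at free boundary points where the obstacle is strictly
superharmonic. -/
lemma porous_of_lapRd_neg {d : ℕ} {u φ : Rd d → ℝ} {U : Set (Rd d)} (hU : IsOpen U)
    (hu : Continuous u) (hφ : ContDiff ℝ 2 φ) (hle : ∀ x, φ x ≤ u x)
    (hsub : WeaklySubharmonicOn u {x | φ x < u x}) (hsup : WeaklySubharmonicOn (-u) U)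
    {x₀ : Rd d} (hxU : x₀ ∈ U) (hx : x₀ ∈ frontier {x | u x = φ x}) (hlap : lapRd φ x₀ < 0) :
    ∃ δ > 0, ∀ᶠ r in 𝓝[>] (0 : ℝ), ∃ y, dist y x₀ ≤ r ∧
      Disjoint {x | u x = φ x} (ball y (δ * r)) := by
  have hclosed : IsClosed {x | u x = φ x} := isClosed_eq hu hφ.continuous
  set c : ℝ := -lapRd φ x₀ / 2 with hc
  set C : ℝ := -2 * lapRd φ x₀ with hC
  have hc0 : 0 < c := by linarith
  have hC0 : 0 < C := by linarith
  have hev : ∀ᶠ x in 𝓝 x₀, x ∈ U ∧ -C < lapRd φ x ∧ lapRd φ x < -c :=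
    (hU.eventually_mem hxU).and
      (((continuous_lapRd hφ).continuousAt.eventually_const_lt (by linarith)).and
        ((continuous_lapRd hφ).continuousAt.eventually_lt_const (by linarith)))
  obtain ⟨R, hR, hball⟩ := Metric.eventually_nhds_iff_ball.1 hev
  have hI := cutoffMass_pos d
  have hT := tailMass_pos d
  set A : ℝ := c / (2 * d + 1) / 4 * cutoffMass d with hA
  set B : ℝ := 8 ^ d * (C * tailMass d * 8) with hB
  have hA0 : 0 < A := by positivity
  have hB0 : 0 < B := by positivity
  obtain ⟨δ, hδ0, hδ1, hδ⟩ : ∃ δ : ℝ, 0 < δ ∧ δ ≤ 1 ∧ B * δ ^ 2 < A := by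
    have hcont : Tendsto (fun δ : ℝ => B * δ ^ 2) (𝓝[>] 0) (𝓝 (B * 0 ^ 2)) :=
      (Continuous.tendsto (by fun_prop) _).mono_left nhdsWithin_le_nhds
    have h1 := hcont.eventually_lt_const (u := A) (by simpa using hA0)
    obtain ⟨δ, hlt, hpos, hle1⟩ := (h1.and (Ioc_mem_nhdsGT (zero_lt_one' ℝ))).exists
    exact ⟨δ, hpos, hle1, hlt⟩
  refine ⟨δ, hδ0, ?_⟩
  filter_upwards [Ioo_mem_nhdsGT (by positivity : 0 < R / 10)] with r ⟨hr0, hrR⟩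
  obtain ⟨x₁, hx₁, hx₁d⟩ : ∃ x₁ ∈ {x | u x = φ x}ᶜ, dist x₀ x₁ < r / 2 :=
    Metric.mem_closure_iff.1 (frontier_subset_closure (by rwa [frontier_compl])) _ (by positivity)
  have hx₁' : φ x₁ < u x₁ := lt_of_le_of_ne (hle x₁) fun h => hx₁ h.symm
  rw [dist_comm] at hx₁d
  obtain ⟨y, hyd, hy⟩ := exists_quadratic_growth hu hφ hsub (ρ := r / 2) (by positivity) hc0 hx₁'
    fun x hx => by
      have := (hball x (by
        have := dist_triangle x x₁ x₀
        rw [mem_ball] at hx ⊢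
        linarith)).2.2
      linarith
  have hyx₀ : dist y x₀ ≤ r := by linarith [dist_triangle y x₁ x₀]
  refine ⟨y, hyx₀, Set.disjoint_left.2 fun z' hz' hz'b => ?_⟩
  obtain ⟨z, hzM, hzd⟩ := hclosed.exists_infDist_eq_dist ⟨z', hz'⟩ y
  have hρle : dist y z < δ * r :=
    hzd ▸ (infDist_le_dist_of_mem hz').trans_lt (by rwa [mem_ball, dist_comm] at hz'b)
  have hyM : φ y < u y := by
    have : 0 < c / (2 * d + 1) * (r / 2) ^ 2 := by positivity
    linarith
  have hρ0 : 0 < dist y z := dist_pos.2 fun h => by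
    rw [h] at hyM
    exact hyM.ne' hzM
  have hρr : dist y z < r := hρle.trans_le (by nlinarith)
  have key := sub_le_sq_dist_contact hu hφ hle hsub (C := C) hρ0 rfl hzM
    (fun x hx => lt_of_le_of_ne (hle x) fun h => by
      have := infDist_le_dist_of_mem (x := y) (show x ∈ {x | u x = φ x} from h.symm)
      rw [mem_ball, dist_comm] at hx
      linarith)
    (fun x hx => by
      have := (hball x (by
        have := dist_triangle x y x₀
        rw [mem_ball] at hx ⊢
        linarith)).2.2
      linarith)
    (hsup.mono fun x hx => (hball x (by
      have := dist_triangle4 x z y x₀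
      rw [mem_ball] at hx ⊢
      rw [dist_comm z y] at this
      linarith)).1)
    (fun x hx => by
      have := (hball x (by
        have := dist_triangle4 x z y x₀
        rw [mem_ball] at hx ⊢
        rw [dist_comm z y] at this
        linarith)).2.1
      linarith)
  have h1 : A * r ^ 2 ≤ (u y - φ y) * cutoffMass d :=
    le_trans (le_of_eq (by rw [hA]; ring)) (mul_le_mul_of_nonneg_right hy hI.le)
  have h2 : B * dist y z ^ 2 ≤ B * (δ * r) ^ 2 := by gcongr
  have h3 : B * δ ^ 2 * r ^ 2 < A * r ^ 2 := by gcongr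
  have h4 : B * (δ * r) ^ 2 = B * δ ^ 2 * r ^ 2 := by ring
  linarith

/-- A set on which `f ≤ 0` is porous at regular zeros of `f`. -/
lemma porous_of_fderiv_ne_zero {d : ℕ} {f : Rd d → ℝ} {S : Set (Rd d)} (hS : ∀ x ∈ S, f x ≤ 0)
    {x₀ : Rd d} (hd : DifferentiableAt ℝ f x₀) (hf0 : f x₀ = 0) (hne : fderiv ℝ f x₀ ≠ 0) :
    ∃ δ > 0, ∀ᶠ r in 𝓝[>] (0 : ℝ), ∃ y, dist y x₀ ≤ r ∧ Disjoint S (ball y (δ * r)) := by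
  set L := fderiv ℝ f x₀ with hL
  obtain ⟨e, he⟩ : ∃ e, L e ≠ 0 := by
    by_contra! h
    exact hne (ContinuousLinearMap.ext h)
  have he0 : e ≠ 0 := fun h => he (by simp [h])
  have hen : 0 < ‖e‖ := norm_pos_iff.2 he0
  obtain ⟨n, hn1, hn2⟩ : ∃ n : Rd d, ‖n‖ = 1 ∧ 0 < L n := by
    refine ⟨((SignType.sign (L e) : ℝ) * ‖e‖⁻¹) • e, ?_, ?_⟩
    · rcases lt_or_gt_of_ne he with h | h <;>
        simp [norm_smul, h, sign_pos, hen.ne']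
    · rw [map_smul, smul_eq_mul]
      rcases lt_or_gt_of_ne he with h | h
      · simp only [sign_neg h, SignType.coe_neg_one]
        have : 0 < ‖e‖⁻¹ * (-L e) := mul_pos (by positivity) (by linarith)
        linarith
      · simp only [sign_pos h, SignType.coe_one]
        positivity
  have hLn : 0 < ‖L‖ := norm_pos_iff.2 hne
  set δ : ℝ := min 1 (L n / (4 * ‖L‖)) with hδ
  have hδ0 : 0 < δ := by positivity
  have hδ1 : δ ≤ 1 := min_le_left _ _
  have hδ2 : ‖L‖ * δ ≤ L n / 4 := by
    calc ‖L‖ * δ ≤ ‖L‖ * (L n / (4 * ‖L‖)) := by gcongr; exact min_le_right _ _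
      _ = L n / 4 := by field_simp
  refine ⟨δ, hδ0, ?_⟩
  have hlittle := hd.hasFDerivAt.isLittleO.def (c := L n / 4) (by positivity)
  obtain ⟨R, hR, hball⟩ := Metric.eventually_nhds_iff_ball.1 hlittle
  filter_upwards [Ioo_mem_nhdsGT (by positivity : 0 < R / 2)] with r ⟨hr0, hrR⟩
  refine ⟨x₀ + r • n, ?_, Set.disjoint_left.2 fun x hxS hx => ?_⟩
  · rw [dist_eq_norm, add_sub_cancel_left, norm_smul, hn1, Real.norm_of_nonneg hr0.le, mul_one]
  · rw [mem_ball, dist_eq_norm] at hx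
    set w := x - (x₀ + r • n) with hw
    have hxw : x - x₀ = r • n + w := by rw [hw]; abel
    have hnr : ‖x - x₀‖ ≤ 2 * r := by
      rw [hxw]
      refine (norm_add_le _ _).trans ?_
      rw [norm_smul, hn1, Real.norm_of_nonneg hr0.le]
      nlinarith
    have h1 := hball x (by rw [mem_ball, dist_eq_norm]; linarith)
    rw [hf0, sub_zero, ← hL, hxw, map_add, map_smul, ← hxw, Real.norm_eq_abs, smul_eq_mul] at h1
    have h2 := (abs_le.1 h1).1
    have h3 : |L w| ≤ ‖L‖ * (δ * r) := (L.le_opNorm w).trans (by gcongr)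
    have h4 := (abs_le.1 h3).1
    have h5 : ‖L‖ * (δ * r) ≤ L n / 4 * r := by
      rw [← mul_assoc]
      gcongr
    have h6 : L n / 4 * ‖x - x₀‖ ≤ L n / 4 * (2 * r) := by gcongr
    have h7 : 0 < r * L n := by positivity
    have h8 := hS x hxS
    nlinarith

/-- The free boundary of a one-sided contact set has measure zero. -/
lemma volume_frontier_contact_eq_zero {d : ℕ} {u φ : Rd d → ℝ} {U : Set (Rd d)} (hU : IsOpen U)
    (hu : Continuous u) (hφ : ContDiff ℝ 4 φ) (hle : ∀ x, φ x ≤ u x)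
    (hMU : {x | u x = φ x} ⊆ U)
    (hsub : WeaklySubharmonicOn u {x | φ x < u x}) (hsup : WeaklySubharmonicOn (-u) U)
    (hnd : ∀ x, lapRd φ x = 0 → fderiv ℝ (lapRd φ) x ≠ 0) :
    volume (frontier {x | u x = φ x}) = 0 := by
  have hφ2 : ContDiff ℝ 2 φ := hφ.of_le (by norm_num)
  have hfr : frontier {x | u x = φ x} ⊆ {x | u x = φ x} :=
    (isClosed_eq hu hφ.continuous).frontier_subset
  have hnonpos : ∀ x ∈ frontier {x | u x = φ x}, lapRd φ x ≤ 0 := fun x hx =>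
    lapRd_nonpos_of_contact hU hu hφ2 hle hsup (hMU (hfr hx)) (hfr hx)
  refine volume_eq_zero_of_porous fun x hx => ?_
  rcases (hnonpos x hx).lt_or_eq with hlt | heq
  · obtain ⟨δ, hδ, h⟩ := porous_of_lapRd_neg hU hu hφ2 hle hsub hsup (hMU (hfr hx)) hx hlt
    refine ⟨δ, hδ, h.mono fun r => ?_⟩
    rintro ⟨y, hy, hdisj⟩
    exact ⟨y, hy, hdisj.mono_left hfr⟩
  · exact porous_of_fderiv_ne_zero hnonpos
      ((contDiff_lapRd (m := 1) hφ (by norm_num)).differentiable (by norm_num) x) heq (hnd x heq)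

/-- **Theorem (the free boundary has Lebesgue measure zero).** -/
theorem dop_free_boundary_measure_zero {d : ℕ}
    (φm φp : Rd d → ℝ) (τ : ℝ) (hτ : 0 < τ)
    (hmreg : ContDiff ℝ 4 φm) (hpreg : ContDiff ℝ 4 φp)
    (hmper : PeriodicRd φm) (hpper : PeriodicRd φp)
    (hmnc : ∃ x y : Rd d, φm x ≠ φm y) (hpnc : ∃ x y : Rd d, φp x ≠ φp y)
    (hsep : ∀ x : Rd d, τ ≤ φp x - φm x)
    (hmaxmin : sInf (Set.range φp) < sSup (Set.range φm))
    (hndm : ∀ x : Rd d, lapRd φm x = 0 → fderiv ℝ (lapRd φm) x ≠ 0)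
    (hndp : ∀ x : Rd d, lapRd φp x = 0 → fderiv ℝ (lapRd φp) x ≠ 0) :
    ∀ u : Rd d → ℝ, IsDOPSolution φm φp u →
      volume (frontier {x : Rd d | u x = φm x}) = 0 ∧
      volume (frontier {x : Rd d | u x = φp x}) = 0 := by
  rintro u ⟨hu, -, hle, hsub, hsup⟩
  have hneg : ∀ χ : Rd d → ℝ, ∫ x, (-u) x * lapRd χ x = -∫ x, u x * lapRd χ x := fun χ => by
    simp [integral_neg]
  have hsub' : WeaklySubharmonicOn u {x | φm x < u x} := hsub
  have hsup' : WeaklySubharmonicOn (-u) {x | u x < φp x} := fun χ h1 h2 h3 h4 => by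
    rw [hneg]
    exact neg_nonneg.2 (hsup χ h1 h2 h3 h4)
  constructor
  · refine volume_frontier_contact_eq_zero (isOpen_lt hu hpreg.continuous) hu hmreg
      (fun x => (hle x).1) (fun x hx => ?_) hsub' hsup' hndm
    have hx : u x = φm x := hx
    have := hsep x
    change u x < φp x
    linarith
  · have h := volume_frontier_contact_eq_zero (u := -u) (φ := -φp) (U := {x | φm x < u x})
      (isOpen_lt hmreg.continuous hu) hu.neg hpreg.neg (fun x => neg_le_neg (hle x).2)
      (fun x hx => ?_) (by simpa using hsup') (by simpa using hsub') (fun x hx => ?_)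
    · simpa using h
    · have hx : -u x = -φp x := hx
      have := hsep x
      change φm x < u x
      linarith
    · rw [lapRd_neg] at hx ⊢
      rw [fderiv_neg]
      exact neg_ne_zero.2 (hndp x (neg_eq_zero.1 hx))
end
end

section
/- (Only the zero singular value for large decay rates; equivalent formulation of Theorem A.1.) Let φ : ℂ → ℝ be a smooth non-constant periodic function and let τ > max_E φ − min_E φ. Then there exists h₀ > 0 such that for all h ∈ (0, h₀] there is no smooth periodic u : ℂ → ℂ satisfying simultaneously: ∫_E |u|² e^{−2φ/h} L(dz) = 1, ∫_E |h∂̄u|² e^{−2φ/h} L(dz) ≤ e^{−2τ/h}, and ∫_E u(z) e^{−2φ(z)/h} L(dz) = 0. (Since the constants are singular states with singular value 0, this expresses that for h small the operator h∂̄ on the weighted space e^{φ/h}L²(M) has precisely one singular value in [0, e^{−τ/h}], namely 0.) -/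
open MeasureTheory Real Complex

noncomputable section

/-- `f : ℂ → α` is 2π-periodic in both the real and the imaginary direction. -/
def PeriodicC {α : Type*} (f : ℂ → α) : Prop :=
  ∀ z : ℂ, f (z + (2 * Real.pi : ℝ)) = f z ∧ f (z + (2 * Real.pi : ℝ) * Complex.I) = f z

/-- The Cauchy–Riemann operator `∂̄ = (∂ₓ + i ∂_y)/2`. -/
noncomputable def dbar (u : ℂ → ℂ) (z : ℂ) : ℂ :=
  (fderiv ℝ u z 1 + Complex.I * fderiv ℝ u z Complex.I) / 2

/-- The Laplacian `Δ = ∂ₓ² + ∂_y²` of a real-valued function on `ℂ ≅ ℝ²`. -/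
noncomputable def lapC (f : ℂ → ℝ) (z : ℂ) : ℝ :=
  fderiv ℝ (fun w => fderiv ℝ f w 1) z 1 +
    fderiv ℝ (fun w => fderiv ℝ f w Complex.I) z Complex.I

/-- The fundamental domain `E = [0,2π) × [0,2π)`. -/
def Efd : Set ℂ :=
  {z : ℂ | z.re ∈ Set.Ico 0 (2 * Real.pi) ∧ z.im ∈ Set.Ico 0 (2 * Real.pi)}

/-- The squared weighted norm `‖u‖_{φ,h}² = ∫_E |u|² e^{-2φ/h}`. -/
noncomputable def wInt (φ : ℂ → ℝ) (h : ℝ) (u : ℂ → ℂ) : ℝ :=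
  ∫ z in Efd, ‖u z‖ ^ 2 * Real.exp (-2 * φ z / h)

/-- The counting function `N(t,h)`: the supremum of `dim V` over finite-dimensional
complex subspaces `V` of smooth periodic functions on which `‖h ∂̄ u‖_{φ,h} ≤ t ‖u‖_{φ,h}`. -/
noncomputable def countN (φ : ℂ → ℝ) (t h : ℝ) : ℕ :=
  sSup {n : ℕ | ∃ V : Submodule ℂ (ℂ → ℂ),
    Module.finrank ℂ V = n ∧
    (∀ u ∈ V, ContDiff ℝ (⊤ : ℕ∞) u ∧ PeriodicC u) ∧
    (∀ u ∈ V, wInt φ h (fun z => (h : ℂ) * dbar u z) ≤ t ^ 2 * wInt φ h u)}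

/-- `v` is distributionally subharmonic on the open set `U`. -/
def DSubhOn (v : ℂ → ℝ) (U : Set ℂ) : Prop :=
  ∀ χ : ℂ → ℝ, ContDiff ℝ (⊤ : ℕ∞) χ → HasCompactSupport χ → (∀ z, 0 ≤ χ z) →
    tsupport χ ⊆ U → 0 ≤ ∫ z : ℂ, v z * lapC χ z

/-- `v` is distributionally superharmonic on the open set `U`. -/
def DSuphOn (v : ℂ → ℝ) (U : Set ℂ) : Prop :=
  ∀ χ : ℂ → ℝ, ContDiff ℝ (⊤ : ℕ∞) χ → HasCompactSupport χ → (∀ z, 0 ≤ χ z) →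
    tsupport χ ⊆ U → (∫ z : ℂ, v z * lapC χ z) ≤ 0

lemma Efd_subset_closed :
    Efd ⊆ Set.Icc 0 (2 * Real.pi) ×ℂ Set.Icc 0 (2 * Real.pi) := fun _ hz =>
  ⟨Set.Ico_subset_Icc_self hz.1, Set.Ico_subset_Icc_self hz.2⟩

lemma measurableSet_Efd : MeasurableSet Efd :=
  (Complex.measurable_re measurableSet_Ico).inter (Complex.measurable_im measurableSet_Ico)

lemma Continuous.integrableOn_Efd {α : Type*} [NormedAddCommGroup α] {f : ℂ → α}
    (hf : Continuous f) : IntegrableOn f Efd :=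
  (hf.continuousOn.integrableOn_compact (isCompact_Icc.reProdIm isCompact_Icc)).mono_set
    Efd_subset_closed

/-- Fubini's theorem on the fundamental domain. -/
lemma setIntegral_Efd {f : ℂ → ℝ} (hf : Continuous f) :
    ∫ z in Efd, f z =
      ∫ x in (0 : ℝ)..2 * Real.pi, ∫ y in (0 : ℝ)..2 * Real.pi, f (x + y * Complex.I) := by
  have hpre : Complex.measurableEquivRealProd.symm ⁻¹' Efd =
      Set.Ico 0 (2 * Real.pi) ×ˢ Set.Ico 0 (2 * Real.pi) := by
    ext p
    simp [Efd, Complex.measurableEquivRealProd_symm_apply, and_assoc]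
  have hc : Continuous fun p : ℝ × ℝ => f (p.1 + p.2 * Complex.I) := by fun_prop
  have hint : IntegrableOn (fun p : ℝ × ℝ => f (p.1 + p.2 * Complex.I))
      (Set.Ico 0 (2 * Real.pi) ×ˢ Set.Ico 0 (2 * Real.pi)) (volume.prod volume) :=
    (hc.continuousOn.integrableOn_compact (isCompact_Icc.prod isCompact_Icc)).mono_set
      (Set.prod_mono Set.Ico_subset_Icc_self Set.Ico_subset_Icc_self)
  rw [← (Complex.volume_preserving_equiv_real_prod.symm).setIntegral_preimage_emb
    (Complex.measurableEquivRealProd.symm.measurableEmbedding), hpre]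
  simp only [Complex.measurableEquivRealProd_symm_apply, Complex.mk_eq_add_mul_I]
  rw [Measure.volume_eq_prod, setIntegral_prod _ hint]
  simp only [intervalIntegral.integral_of_le Real.two_pi_pos.le, integral_Ico_eq_integral_Ioc]

lemma setIntegral_Efd_swap {f : ℂ → ℝ} (hf : Continuous f) :
    ∫ z in Efd, f z =
      ∫ y in (0 : ℝ)..2 * Real.pi, ∫ x in (0 : ℝ)..2 * Real.pi, f (x + y * Complex.I) := by
  rw [setIntegral_Efd hf]
  have hc : Continuous (Function.uncurry fun x y : ℝ => f (x + y * Complex.I)) := by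
    unfold Function.uncurry
    fun_prop
  refine intervalIntegral_intervalIntegral_swap ?_
  refine (hc.continuousOn.integrableOn_compact
    (isCompact_uIcc.prod isCompact_uIcc)).mono_set
      (Set.prod_mono Set.uIoc_subset_uIcc Set.uIoc_subset_uIcc)

lemma hasDerivAt_horizontal {F : Type*} [NormedAddCommGroup F] [NormedSpace ℝ F] {u : ℂ → F}
    (hu : Differentiable ℝ u) (x y : ℝ) :
    HasDerivAt (fun s : ℝ => u (s + y * Complex.I)) (fderiv ℝ u (x + y * Complex.I) 1) x := by
  have h1 : HasDerivAt (fun s : ℝ => (s : ℂ) + y * Complex.I) 1 x :=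
    (Complex.ofRealCLM.hasDerivAt (x := x)).add_const _
  exact (hu _).hasFDerivAt.comp_hasDerivAt x h1

lemma hasDerivAt_vertical {F : Type*} [NormedAddCommGroup F] [NormedSpace ℝ F] {u : ℂ → F}
    (hu : Differentiable ℝ u) (x y : ℝ) :
    HasDerivAt (fun t : ℝ => u (x + t * Complex.I))
      (fderiv ℝ u (x + y * Complex.I) Complex.I) y := by
  have h1 : HasDerivAt (fun t : ℝ => (x : ℂ) + t * Complex.I) Complex.I y := by
    simpa using ((Complex.ofRealCLM.hasDerivAt (x := y)).mul_const Complex.I).const_add (x : ℂ)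
  exact (hu _).hasFDerivAt.comp_hasDerivAt y h1

lemma PeriodicC.fderiv {F : Type*} [NormedAddCommGroup F] [NormedSpace ℝ F] {u : ℂ → F}
    (hu : PeriodicC u) : PeriodicC (fderiv ℝ u) := fun z => by
  constructor
  · rw [← fderiv_comp_add_right]
    exact congrArg (fun g => _root_.fderiv ℝ g z) (funext fun w => (hu w).1)
  · rw [← fderiv_comp_add_right]
    exact congrArg (fun g => _root_.fderiv ℝ g z) (funext fun w => (hu w).2)

/-- The horizontal derivative of a periodic function has mean zero. -/
lemma setIntegral_Efd_fderiv_one {g : ℂ → ℝ} (hg : ContDiff ℝ 1 g) (hp : PeriodicC g) :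
    ∫ z in Efd, fderiv ℝ g z 1 = 0 := by
  have hc : Continuous fun z => fderiv ℝ g z 1 :=
    (hg.continuous_fderiv one_ne_zero).clm_apply continuous_const
  rw [setIntegral_Efd_swap hc]
  refine (intervalIntegral.integral_congr (g := fun _ => 0) fun y _ => ?_).trans (by simp)
  have hcy : Continuous fun x : ℝ => fderiv ℝ g (x + y * Complex.I) 1 :=
    hc.comp (g := fun z => fderiv ℝ g z 1) (by fun_prop)
  simp only
  rw [intervalIntegral.integral_eq_sub_of_hasDerivAt
    (fun x _ => hasDerivAt_horizontal (hg.differentiable one_ne_zero) x y)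
    (hcy.intervalIntegrable _ _), sub_eq_zero, ← (hp (((0 : ℝ) : ℂ) + y * Complex.I)).1]
  congr 1
  push_cast
  ring

/-- The vertical derivative of a periodic function has mean zero. -/
lemma setIntegral_Efd_fderiv_I {g : ℂ → ℝ} (hg : ContDiff ℝ 1 g) (hp : PeriodicC g) :
    ∫ z in Efd, fderiv ℝ g z Complex.I = 0 := by
  have hc : Continuous fun z => fderiv ℝ g z Complex.I :=
    (hg.continuous_fderiv one_ne_zero).clm_apply continuous_const
  rw [setIntegral_Efd hc]
  refine (intervalIntegral.integral_congr (g := fun _ => 0) fun x _ => ?_).trans (by simp)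
  have hcx : Continuous fun y : ℝ => fderiv ℝ g (x + y * Complex.I) Complex.I :=
    hc.comp (g := fun z => fderiv ℝ g z Complex.I) (by fun_prop)
  simp only
  rw [intervalIntegral.integral_eq_sub_of_hasDerivAt
    (fun y _ => hasDerivAt_vertical (hg.differentiable one_ne_zero) x y)
    (hcx.intervalIntegrable _ _), sub_eq_zero, ← (hp ((x : ℂ) + ((0 : ℝ) : ℂ) * Complex.I)).2]
  congr 1
  push_cast
  ring

/-- The Jacobian determinant of a periodic map has mean zero. -/
lemma setIntegral_Efd_jacobian {p q : ℂ → ℝ} (hp : ContDiff ℝ 2 p) (hq : ContDiff ℝ 2 q)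
    (hpp : PeriodicC p) (hqp : PeriodicC q) :
    ∫ z in Efd, (fderiv ℝ q z 1 * fderiv ℝ p z Complex.I
      - fderiv ℝ p z 1 * fderiv ℝ q z Complex.I) = 0 := by
  have hdp : ContDiff ℝ 1 (fderiv ℝ p) := hp.fderiv_right (by norm_num)
  have hq1 : ContDiff ℝ 1 q := hq.of_le (by norm_num)
  have hap : ∀ v, ContDiff ℝ 1 fun z => fderiv ℝ p z v := fun v => hdp.clm_apply contDiff_const
  have hF : ∀ v, ContDiff ℝ 1 fun z => q z * fderiv ℝ p z v := fun v => hq1.mul (hap v)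
  have hFp : ∀ v, PeriodicC fun z => q z * fderiv ℝ p z v := fun v z =>
    ⟨by simp only [(hqp z).1, (hpp.fderiv z).1], by simp only [(hqp z).2, (hpp.fderiv z).2]⟩
  have hder : ∀ v w z, fderiv ℝ (fun z => q z * fderiv ℝ p z v) z w =
      q z * fderiv ℝ (fderiv ℝ p) z w v + fderiv ℝ p z v * fderiv ℝ q z w := by
    intro v w z
    have h1 := hdp.differentiable one_ne_zero z
    rw [fderiv_fun_mul (hq1.differentiable one_ne_zero z)
      ((hap v).differentiable one_ne_zero z), fderiv_clm_apply h1 (differentiableAt_const v)]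
    simp
  have hsymm : ∀ z, fderiv ℝ (fderiv ℝ p) z 1 Complex.I = fderiv ℝ (fderiv ℝ p) z Complex.I 1 :=
    fun z => (hp.contDiffAt.isSymmSndFDerivAt (by simp)).eq 1 Complex.I
  have hint : ∀ v w, IntegrableOn
      (fun z => fderiv ℝ (fun z => q z * fderiv ℝ p z v) z w) Efd := fun v w =>
    (((hF v).continuous_fderiv one_ne_zero).clm_apply continuous_const).integrableOn_Efd
  calc _ = ∫ z in Efd, (fderiv ℝ (fun z => q z * fderiv ℝ p z Complex.I) z 1
        - fderiv ℝ (fun z => q z * fderiv ℝ p z 1) z Complex.I) := by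
        congr 1 with z
        rw [hder, hder, hsymm]
        ring
    _ = 0 := by
        rw [integral_sub (hint _ _) (hint _ _), setIntegral_Efd_fderiv_one (hF _) (hFp _),
          setIntegral_Efd_fderiv_I (hF _) (hFp _), sub_zero]

/-- On the torus `4 ‖∂̄u‖² = ‖∇u‖²`. -/
lemma setIntegral_Efd_dbar {u : ℂ → ℂ} (hu : ContDiff ℝ 2 u) (hp : PeriodicC u) :
    4 * ∫ z in Efd, ‖dbar u z‖ ^ 2 =
      (∫ z in Efd, ‖fderiv ℝ u z 1‖ ^ 2) + ∫ z in Efd, ‖fderiv ℝ u z Complex.I‖ ^ 2 := by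
  have hd := hu.differentiable two_ne_zero
  have hre : ∀ z v, fderiv ℝ (fun w => (u w).re) z v = (fderiv ℝ u z v).re := fun z v => by
    have := (Complex.reCLM.hasFDerivAt.comp z (hd z).hasFDerivAt).fderiv
    exact congrArg (fun L => L v) this
  have him : ∀ z v, fderiv ℝ (fun w => (u w).im) z v = (fderiv ℝ u z v).im := fun z v => by
    have := (Complex.imCLM.hasFDerivAt.comp z (hd z).hasFDerivAt).fderiv
    exact congrArg (fun L => L v) this
  have hJ := setIntegral_Efd_jacobian (Complex.reCLM.contDiff.comp hu)
    (Complex.imCLM.contDiff.comp hu)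
    (fun z => ⟨congrArg Complex.re (hp z).1, congrArg Complex.re (hp z).2⟩)
    (fun z => ⟨congrArg Complex.im (hp z).1, congrArg Complex.im (hp z).2⟩)
  simp only [Function.comp_def, Complex.reCLM_apply, Complex.imCLM_apply, hre, him] at hJ
  have hc : ∀ v, Continuous fun z => fderiv ℝ u z v := fun v =>
    (hu.continuous_fderiv two_ne_zero).clm_apply continuous_const
  have hc1 := hc 1
  have hcI := hc Complex.I
  have i1 : IntegrableOn (fun z => ‖fderiv ℝ u z 1‖ ^ 2) Efd :=
    Continuous.integrableOn_Efd (by fun_prop)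
  have i2 : IntegrableOn (fun z => ‖fderiv ℝ u z Complex.I‖ ^ 2) Efd :=
    Continuous.integrableOn_Efd (by fun_prop)
  have i3 : IntegrableOn (fun z => 2 * ((fderiv ℝ u z 1).im * (fderiv ℝ u z Complex.I).re
      - (fderiv ℝ u z 1).re * (fderiv ℝ u z Complex.I).im)) Efd :=
    Continuous.integrableOn_Efd (by fun_prop)
  have h3 := integral_const_mul (μ := volume.restrict Efd) 2
    fun z => ((fderiv ℝ u z 1).im * (fderiv ℝ u z Complex.I).re
      - (fderiv ℝ u z 1).re * (fderiv ℝ u z Complex.I).im)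
  rw [hJ, mul_zero] at h3
  rw [← integral_const_mul, ← integral_add i1 i2,
    ← add_zero (∫ z in Efd, (‖fderiv ℝ u z 1‖ ^ 2 + _)), ← h3]
  refine Eq.trans ?_ (integral_add (i1.add i2) i3)
  congr 1 with z
  simp only [dbar, Complex.sq_norm, Complex.normSq_apply, Complex.div_ofNat_re,
    Complex.div_ofNat_im, Complex.add_re, Complex.add_im, Complex.mul_re, Complex.mul_im,
    Complex.I_re, Complex.I_im]
  ring

lemma sq_intervalIntegral_le {T : ℝ} (hT : 0 < T) {g : ℝ → ℝ} (hg : Continuous g) :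
    (∫ x in (0 : ℝ)..T, g x) ^ 2 ≤ T * ∫ x in (0 : ℝ)..T, g x ^ 2 := by
  set m := ∫ x in (0 : ℝ)..T, g x with hm
  have h0 : 0 ≤ ∫ x in (0 : ℝ)..T, (T * g x - m) ^ 2 :=
    intervalIntegral.integral_nonneg hT.le fun x _ => sq_nonneg _
  have hI : ∀ {f : ℝ → ℝ}, Continuous f → IntervalIntegrable f volume 0 T :=
    fun hf => hf.intervalIntegrable _ _
  have h1 : ∫ x in (0 : ℝ)..T, (T * g x - m) ^ 2 =
      T ^ 2 * (∫ x in (0 : ℝ)..T, g x ^ 2) - (2 * T * m) * m + T * m ^ 2 := by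
    calc _ = ∫ x in (0 : ℝ)..T, (T ^ 2 * g x ^ 2 - (2 * T * m) * g x + m ^ 2) := by
          congr 1 with x
          ring
      _ = _ := by
          rw [intervalIntegral.integral_add (hI (by fun_prop)) (hI (by fun_prop)),
            intervalIntegral.integral_sub (hI (by fun_prop)) (hI (by fun_prop)),
            intervalIntegral.integral_const_mul, intervalIntegral.integral_const_mul, ← hm]
          simp
  rw [h1] at h0
  have h2 : 0 ≤ T * (T * (∫ x in (0 : ℝ)..T, g x ^ 2) - m ^ 2) := by linarith
  linarith [nonneg_of_mul_nonneg_right h2 hT]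

/-- The oscillation of a `C¹` function on an interval is controlled by its Dirichlet energy. -/
lemma norm_sub_sq_le_energy {T : ℝ} (hT : 0 < T) {f f' : ℝ → ℂ}
    (hf : ∀ x, HasDerivAt f (f' x) x) (hf' : Continuous f') {s t : ℝ}
    (hs : s ∈ Set.Icc 0 T) (ht : t ∈ Set.Icc 0 T) :
    ‖f t - f s‖ ^ 2 ≤ T * ∫ x in (0 : ℝ)..T, ‖f' x‖ ^ 2 := by
  refine le_trans ?_ (sq_intervalIntegral_le hT hf'.norm)
  rw [← intervalIntegral.integral_eq_sub_of_hasDerivAt (fun x _ => hf x)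
    (hf'.intervalIntegrable s t)]
  gcongr
  refine intervalIntegral.norm_integral_le_abs_integral_norm.trans ?_
  rw [← abs_of_nonneg (intervalIntegral.integral_nonneg (f := fun x => ‖f' x‖) hT.le
    fun x _ => norm_nonneg _)]
  refine intervalIntegral.abs_integral_mono_interval ?_
    (Filter.Eventually.of_forall fun x => norm_nonneg _) (hf'.norm.intervalIntegrable _ _)
  rw [Set.uIoc_of_le hT.le]
  exact Set.Ioc_subset_Ioc (le_min hs.1 ht.1) (max_le hs.2 ht.2)

/-- A Poincaré inequality on the torus for the Cauchy–Riemann operator. -/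
lemma exists_setIntegral_norm_sub_sq_le_dbar {u : ℂ → ℂ} (hu : ContDiff ℝ 2 u)
    (hp : PeriodicC u) :
    ∃ c : ℂ, ∫ z in Efd, ‖u z - c‖ ^ 2 ≤
      8 * (2 * Real.pi) ^ 2 * ∫ z in Efd, ‖dbar u z‖ ^ 2 := by
  have hd := hu.differentiable two_ne_zero
  have hcu := hu.continuous
  have hc : ∀ v, Continuous fun z => fderiv ℝ u z v := fun v =>
    (hu.continuous_fderiv two_ne_zero).clm_apply continuous_const
  have hc1 := hc 1
  have hcI := hc Complex.I
  have hT : (0 : ℝ) < 2 * Real.pi := Real.two_pi_pos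
  have hdb := setIntegral_Efd_dbar hu hp
  have hline : ∀ v, Continuous fun p : ℝ × ℝ => ‖fderiv ℝ u (p.1 + p.2 * Complex.I) v‖ ^ 2 :=
    fun v => ((hc v).comp (g := fun z => fderiv ℝ u z v)
      (f := fun p : ℝ × ℝ => (p.1 : ℂ) + p.2 * Complex.I) (by fun_prop)).norm.pow 2
  rw [setIntegral_Efd_swap (f := fun z => ‖fderiv ℝ u z 1‖ ^ 2) (by fun_prop),
    setIntegral_Efd (f := fun z => ‖fderiv ℝ u z Complex.I‖ ^ 2) (by fun_prop)] at hdb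
  generalize hT' : 2 * Real.pi = T at hT hdb
  set A : ℝ → ℝ := fun y => ∫ x in (0 : ℝ)..T, ‖fderiv ℝ u (x + y * Complex.I) 1‖ ^ 2
  set B : ℝ → ℝ := fun x => ∫ y in (0 : ℝ)..T, ‖fderiv ℝ u (x + y * Complex.I) Complex.I‖ ^ 2
  have hAc : Continuous A :=
    intervalIntegral.continuous_parametric_intervalIntegral_of_continuous'
      (f := fun (y x : ℝ) => ‖fderiv ℝ u (x + y * Complex.I) 1‖ ^ 2)
      ((hline 1).comp continuous_swap) 0 T
  have hBc : Continuous B :=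
    intervalIntegral.continuous_parametric_intervalIntegral_of_continuous'
      (f := fun (x y : ℝ) => ‖fderiv ℝ u (x + y * Complex.I) Complex.I‖ ^ 2)
      (hline Complex.I) 0 T
  obtain ⟨a, ha, haB⟩ : ∃ a ∈ Set.Icc 0 T, T * B a ≤ ∫ x in (0 : ℝ)..T, B x := by
    by_contra! hcon
    have hlt := intervalIntegral.integral_lt_integral_of_continuousOn_of_le_of_exists_lt
      (f := fun _ => (∫ x in (0 : ℝ)..T, B x) / T) (g := B) hT continuousOn_const
      hBc.continuousOn
      (fun x hx => ((div_lt_iff₀' hT).2 (hcon x (Set.Ioc_subset_Icc_self hx))).le)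
      ⟨0, Set.left_mem_Icc.2 hT.le, (div_lt_iff₀' hT).2 (hcon 0 (Set.left_mem_Icc.2 hT.le))⟩
    rw [intervalIntegral.integral_const, sub_zero, smul_eq_mul, mul_div_cancel₀ _ hT.ne'] at hlt
    exact hlt.false
  have hpt : ∀ x ∈ Set.Icc 0 T, ∀ y ∈ Set.Icc 0 T,
      ‖u (x + y * Complex.I) - u (a + (0 : ℝ) * Complex.I)‖ ^ 2 ≤
        2 * T * A y + 2 * T * B a := by
    intro x hx y hy
    have h1 := norm_sub_sq_le_energy hT (fun s => hasDerivAt_horizontal hd s y)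
      (hc1.comp (g := fun z => fderiv ℝ u z 1) (by fun_prop)) ha hx
    have h2 := norm_sub_sq_le_energy hT (fun t => hasDerivAt_vertical hd a t)
      (hcI.comp (g := fun z => fderiv ℝ u z Complex.I) (by fun_prop))
      (Set.left_mem_Icc.2 hT.le) hy
    have h3 := norm_add_le (u (x + y * Complex.I) - u (a + y * Complex.I))
      (u (a + y * Complex.I) - u (a + (0 : ℝ) * Complex.I))
    rw [sub_add_sub_cancel] at h3
    have h4 := pow_le_pow_left₀ (norm_nonneg _) h3 2
    change _ ≤ T * A y at h1
    change _ ≤ T * B a at h2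
    nlinarith [sq_nonneg (‖u (x + y * Complex.I) - u (a + y * Complex.I)‖
      - ‖u (a + y * Complex.I) - u (a + (0 : ℝ) * Complex.I)‖)]
  refine ⟨u (a + (0 : ℝ) * Complex.I), ?_⟩
  rw [setIntegral_Efd (f := fun z => ‖u z - u (a + (0 : ℝ) * Complex.I)‖ ^ 2) (by fun_prop), hT']
  have hrow : ∀ x ∈ Set.Icc 0 T,
      ∫ y in (0 : ℝ)..T, ‖u (x + y * Complex.I) - u (a + (0 : ℝ) * Complex.I)‖ ^ 2 ≤
        2 * T * (∫ y in (0 : ℝ)..T, A y) + T * (2 * T * B a) := by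
    intro x hx
    refine (intervalIntegral.integral_mono_on hT.le
      (Continuous.intervalIntegrable (by fun_prop) _ _)
      (Continuous.intervalIntegrable (by fun_prop) _ _) (hpt x hx)).trans_eq ?_
    rw [intervalIntegral.integral_add (Continuous.intervalIntegrable (by fun_prop) _ _)
      (Continuous.intervalIntegrable (by fun_prop) _ _), intervalIntegral.integral_const_mul,
      intervalIntegral.integral_const, sub_zero, smul_eq_mul]
  have hcc : Continuous fun x : ℝ =>
      ∫ y in (0 : ℝ)..T, ‖u (x + y * Complex.I) - u (a + (0 : ℝ) * Complex.I)‖ ^ 2 :=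
    intervalIntegral.continuous_parametric_intervalIntegral_of_continuous'
      (by unfold Function.uncurry; fun_prop) 0 T
  refine (intervalIntegral.integral_mono_on hT.le (hcc.intervalIntegrable _ _)
    (Continuous.intervalIntegrable continuous_const _ _) hrow).trans ?_
  rw [intervalIntegral.integral_const, sub_zero, smul_eq_mul]
  have h5 := mul_le_mul_of_nonneg_left haB (by positivity : 0 ≤ 2 * T ^ 2)
  have h6 : (8 * T ^ 2) * ∫ z in Efd, ‖dbar u z‖ ^ 2 = 2 * T ^ 2 *
      ((∫ y in (0 : ℝ)..T, A y) + ∫ x in (0 : ℝ)..T, B x) := by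
    rw [← hdb]
    ring
  linarith

/-- Subtracting a constant does not decrease the weighted norm of a function that is orthogonal
to the constants. -/
lemma wInt_le_wInt_sub_const {φ : ℂ → ℝ} (hφ : Continuous φ) {h : ℝ} {u : ℂ → ℂ}
    (hu : Continuous u)
    (horth : (∫ z in Efd, u z * (Real.exp (-2 * φ z / h) : ℂ)) = 0) (c : ℂ) :
    wInt φ h u ≤ wInt φ h fun z => u z - c := by
  have hre : ∫ z in Efd, 2 * (starRingEnd ℂ c * (u z * (Real.exp (-2 * φ z / h) : ℂ))).re = 0 := by
    have hint : IntegrableOn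
        (fun z => starRingEnd ℂ c * (u z * (Real.exp (-2 * φ z / h) : ℂ))) Efd :=
      Continuous.integrableOn_Efd (by fun_prop)
    have := Complex.reCLM.integral_comp_comm hint
    simp only [Complex.reCLM_apply] at this
    rw [integral_const_mul, this, integral_const_mul, horth]
    simp
  rw [← sub_zero (wInt φ h u), ← hre, wInt, wInt, ← integral_sub
    (Continuous.integrableOn_Efd (by fun_prop)) (Continuous.integrableOn_Efd (by fun_prop))]
  refine integral_mono (Continuous.integrableOn_Efd (by fun_prop))
    (Continuous.integrableOn_Efd (by fun_prop)) fun z => ?_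
  simp only [Complex.sq_norm, Complex.normSq_apply, Complex.mul_re, Complex.mul_im,
    Complex.conj_re, Complex.conj_im, Complex.ofReal_re, Complex.ofReal_im, Complex.sub_re,
    Complex.sub_im]
  have hw := Real.exp_pos (-2 * φ z / h)
  nlinarith [mul_nonneg (add_nonneg (sq_nonneg c.re) (sq_nonneg c.im)) hw.le]

lemma wInt_le_of_le {φ : ℂ → ℝ} (hφ : Continuous φ) {h m : ℝ} (hh : 0 < h)
    (hm : ∀ z ∈ Efd, m ≤ φ z) {u : ℂ → ℂ} (hu : Continuous u) :
    wInt φ h u ≤ Real.exp (-2 * m / h) * ∫ z in Efd, ‖u z‖ ^ 2 := by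
  rw [← integral_const_mul]
  refine setIntegral_mono_on (Continuous.integrableOn_Efd (by fun_prop))
    (Continuous.integrableOn_Efd (by fun_prop)) measurableSet_Efd fun z hz => ?_
  rw [mul_comm]
  gcongr ?_ * _
  refine Real.exp_le_exp.2 (div_le_div_of_nonneg_right ?_ hh.le)
  linarith [hm z hz]

lemma le_wInt_of_le {φ : ℂ → ℝ} (hφ : Continuous φ) {h m : ℝ} (hh : 0 < h)
    (hm : ∀ z ∈ Efd, φ z ≤ m) {u : ℂ → ℂ} (hu : Continuous u) :
    Real.exp (-2 * m / h) * (∫ z in Efd, ‖u z‖ ^ 2) ≤ wInt φ h u := by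
  rw [← integral_const_mul]
  refine setIntegral_mono_on (Continuous.integrableOn_Efd (by fun_prop))
    (Continuous.integrableOn_Efd (by fun_prop)) measurableSet_Efd fun z hz => ?_
  rw [mul_comm]
  gcongr _ * ?_
  refine Real.exp_le_exp.2 (div_le_div_of_nonneg_right ?_ hh.le)
  linarith [hm z hz]

lemma exp_neg_two_div_le {δ h : ℝ} (hδ : 0 < δ) (hh : 0 < h) :
    Real.exp (-2 * δ / h) ≤ 6 * h ^ 3 / (8 * δ ^ 3) := by
  have h1 := Real.pow_div_factorial_le_exp (2 * δ / h) (by positivity) 3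
  have h2 : -2 * δ / h = -(2 * δ / h) := by ring
  rw [h2, Real.exp_neg]
  refine (inv_anti₀ (by positivity) h1).trans_eq ?_
  simp only [Nat.factorial]
  push_cast
  field_simp
  norm_num

/-- **Theorem (only the zero singular value for large decay rates).** For small `h`
there is no normalized quasimode with exponentially small `h ∂̄`-error that is
orthogonal, in `L²_φ`, to the constants (the singular states of singular value `0`). -/
theorem only_zero_singular_value_large_decay
    (φ : ℂ → ℝ) (hφ : ContDiff ℝ (⊤ : ℕ∞) φ) (hφp : PeriodicC φ) (hφnc : ∃ z w : ℂ, φ z ≠ φ w)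
    (τ : ℝ) (hτ : sSup (φ '' Efd) - sInf (φ '' Efd) < τ) :
    ∃ h₀ > 0, ∀ h : ℝ, 0 < h → h ≤ h₀ →
      ¬ ∃ u : ℂ → ℂ, ContDiff ℝ (⊤ : ℕ∞) u ∧ PeriodicC u ∧
        wInt φ h u = 1 ∧
        wInt φ h (fun z => (h : ℂ) * dbar u z) ≤ Real.exp (-2 * τ / h) ∧
        (∫ z in Efd, u z * (Real.exp (-2 * φ z / h) : ℂ)) = 0 := by
  have hcφ := hφ.continuous
  have hbdd : IsCompact (φ '' (Set.Icc 0 (2 * Real.pi) ×ℂ Set.Icc 0 (2 * Real.pi))) :=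
    (isCompact_Icc.reProdIm isCompact_Icc).image hcφ
  have hM : ∀ z ∈ Efd, φ z ≤ sSup (φ '' Efd) := fun z hz =>
    le_csSup (hbdd.bddAbove.mono (Set.image_mono Efd_subset_closed)) (Set.mem_image_of_mem φ hz)
  have hm : ∀ z ∈ Efd, sInf (φ '' Efd) ≤ φ z := fun z hz =>
    csInf_le (hbdd.bddBelow.mono (Set.image_mono Efd_subset_closed)) (Set.mem_image_of_mem φ hz)
  generalize sSup (φ '' Efd) = M at hτ hM
  generalize sInf (φ '' Efd) = m at hτ hm
  have hδ : 0 < τ - (M - m) := sub_pos.2 hτ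
  set δ := τ - (M - m) with hδ'
  set T := 2 * Real.pi
  have hT : 0 < T := Real.two_pi_pos
  refine ⟨δ ^ 3 / (12 * T ^ 2), by positivity, ?_⟩
  rintro h hh hh0 ⟨u, hu, hup, hnorm, hsmall, horth⟩
  have hu2 : ContDiff ℝ 2 u := hu.of_le (WithTop.coe_le_coe.2 (le_top : (2 : ℕ∞) ≤ ⊤))
  have hcu := hu.continuous
  have hcd : Continuous (dbar u) := by
    have hc : ∀ v, Continuous fun z => fderiv ℝ u z v := fun v =>
      (hu2.continuous_fderiv two_ne_zero).clm_apply continuous_const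
    exact ((hc 1).add (continuous_const.mul (hc Complex.I))).div_const 2
  obtain ⟨c, hc⟩ := exists_setIntegral_norm_sub_sq_le_dbar hu2 hup
  have h1 : 1 ≤ Real.exp (-2 * m / h) * ∫ z in Efd, ‖u z - c‖ ^ 2 :=
    hnorm.symm.le.trans <| (wInt_le_wInt_sub_const hcφ hcu horth c).trans <|
      wInt_le_of_le hcφ hh hm (by fun_prop)
  have h2 := (le_wInt_of_le hcφ hh hM (u := fun z => (h : ℂ) * dbar u z) (by fun_prop)).trans
    hsmall
  simp only [norm_mul, mul_pow, Complex.norm_real, Real.norm_eq_abs, sq_abs,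
    integral_const_mul] at h2
  set D := ∫ z in Efd, ‖dbar u z‖ ^ 2
  have h3 : h ^ 2 * (Real.exp (-2 * m / h) * D) ≤ Real.exp (-2 * δ / h) := by
    have h4 := mul_le_mul_of_nonneg_left h2 (Real.exp_pos (2 * (M - m) / h)).le
    rw [← Real.exp_add, ← mul_assoc, ← Real.exp_add] at h4
    have e1 : 2 * (M - m) / h + -2 * M / h = -2 * m / h := by ring
    have e2 : 2 * (M - m) / h + -2 * τ / h = -2 * δ / h := by rw [hδ']; ring
    rw [e1, e2] at h4
    linarith
  have h5 : 1 ≤ 8 * T ^ 2 * (Real.exp (-2 * m / h) * D) := by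
    have := mul_le_mul_of_nonneg_left hc (Real.exp_pos (-2 * m / h)).le
    linarith
  have h6 : h ^ 2 ≤ 8 * T ^ 2 * (6 * h ^ 3 / (8 * δ ^ 3)) := by
    have h7 := h3.trans (exp_neg_two_div_le hδ hh)
    have h8 := mul_le_mul_of_nonneg_left h7 (by positivity : 0 ≤ 8 * T ^ 2)
    have h9 := mul_le_mul_of_nonneg_left h5 (by positivity : 0 ≤ h ^ 2)
    linarith
  have h10 : 8 * T ^ 2 * (6 * h ^ 3 / (8 * δ ^ 3)) = h ^ 2 * (6 * T ^ 2 / δ ^ 3 * h) := by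
    field_simp
  have h11 : 6 * T ^ 2 / δ ^ 3 * h ≤ 1 / 2 := by
    refine (mul_le_mul_of_nonneg_left hh0 (by positivity)).trans_eq ?_
    field_simp
    norm_num
  nlinarith [pow_pos hh 2]
end
end
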